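/- Let n ≥ 1, 1 ≤ r ≤ n, and 1 ≤ M ≤ 2^n be integers with α := M/2^n ≤ 1/2. Then Γ_B^(n)(M,r) ≤ α²·[1 − ψ_n^+(α,r)/C(n,≤r)] + α(1−α)·C(n−1,r)/C(n,≤r). -/

import Mathlib

open Finset

noncomputable section

/-- The Hamming ball of radius `r` around the all-ones vector in `{-1,1}^n`
(vertices modeled as `Fin n → ℤˣ`, where `ℤˣ = {1, -1}`). -/
def hBall (n r : ℕ) : Finset (Fin n → ℤˣ) :=
  Finset.univ.filter fun z => hammingDist z 1 ≤ r

/-- The Hamming sphere of radius `r` around the all-ones vector. -/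
def hSphere (n r : ℕ) : Finset (Fin n → ℤˣ) :=
  Finset.univ.filter fun z => hammingDist z 1 = r

/-- Ball-noise stability `E[f(X) f(X∘Z)]`, `X` uniform on the cube, `Z` uniform on `B_r`. -/
def BStab (n r : ℕ) (f : (Fin n → ℤˣ) → ℝ) : ℝ :=
  (∑ x : Fin n → ℤˣ, ∑ z ∈ hBall n r, f x * f (x * z)) / (2 ^ n * (hBall n r).card)

/-- Sphere-noise stability `E[f(X) f(X∘Z)]`, `X` uniform on the cube, `Z` uniform on `S_r`. -/
def SStab (n r : ℕ) (f : (Fin n → ℤˣ) → ℝ) : ℝ :=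
  (∑ x : Fin n → ℤˣ, ∑ z ∈ hSphere n r, f x * f (x * z)) / (2 ^ n * (hSphere n r).card)

/-- i.i.d.-noise stability `E[f(X) f(X∘Z)]`, `Z` with i.i.d. coordinates equal to `-1`
with probability `β` and `1` with probability `1-β`. -/
def Stab (n : ℕ) (β : ℝ) (f : (Fin n → ℤˣ) → ℝ) : ℝ :=
  (∑ x : Fin n → ℤˣ, ∑ z : Fin n → ℤˣ,
      (∏ i, if z i = 1 then 1 - β else β) * (f x * f (x * z))) / 2 ^ n

/-- Indicator function of a set `A` of vertices. -/
def indic (n : ℕ) (A : Finset (Fin n → ℤˣ)) : (Fin n → ℤˣ) → ℝ :=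
  fun x => if x ∈ A then 1 else 0

/-- `Γ_B^(n)(M,r)`: maximal ball-noise stability over Boolean functions with exactly `M` ones. -/
def GammaB (n M r : ℕ) : ℝ :=
  sSup {y | ∃ A : Finset (Fin n → ℤˣ), A.card = M ∧ y = BStab n r (indic n A)}

/-- `Γ_S^(n)(M,r)`: maximal sphere-noise stability over Boolean functions with exactly `M` ones. -/
def GammaS (n M r : ℕ) : ℝ :=
  sSup {y | ∃ A : Finset (Fin n → ℤˣ), A.card = M ∧ y = SStab n r (indic n A)}

/-- `Γ_IID^(n)(M,β)`: maximal i.i.d.-noise stability over Boolean functions with exactly `M` ones. -/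
def GammaIID (n M : ℕ) (β : ℝ) : ℝ :=
  sSup {y | ∃ A : Finset (Fin n → ℤˣ), A.card = M ∧ y = Stab n β (indic n A)}

/-- `Γ_IID(α,β) := sup_n Γ_IID^(n)(⌊α·2^n⌋, β)` (equivalently the limit, by monotonicity). -/
def GammaIIDlim (α β : ℝ) : ℝ := ⨆ n : ℕ, GammaIID n ⌊α * 2 ^ n⌋₊ β

/-- `C(n, ≤ r) = Σ_{i=0}^r C(n,i)`. -/
def ballBinom (n r : ℕ) : ℕ := ∑ i ∈ Finset.range (r + 1), n.choose i

/-- Generalized binomial coefficient `C(x, j) = x(x-1)⋯(x-j+1)/j!` for real `x`. -/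
def rchoose (x : ℝ) (j : ℕ) : ℝ := (∏ i ∈ Finset.range j, (x - i)) / (Nat.factorial j)

/-- Krawtchouk polynomial `K_k^(n)(x) = Σ_{j=0}^k (-1)^j C(x,j) C(n-x, k-j)`. -/
def kraw (n k : ℕ) (x : ℝ) : ℝ :=
  ∑ j ∈ Finset.range (k + 1), (-1 : ℝ) ^ j * rchoose x j * rchoose ((n : ℝ) - x) (k - j)

open scoped Classical

/-- `τ(n) = (1/2)(n/2 + 2 − √(n/2+2))`. -/
def tau (n : ℕ) : ℝ := (1 / 2) * ((n : ℝ) / 2 + 2 - Real.sqrt ((n : ℝ) / 2 + 2))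

/-- Membership in the set `F` from the linear programming bound. -/
def inF (n r k : ℕ) : Prop :=
  (Even k ∧ ((n : ℝ) + r + 1) / 2 ≤ (k : ℝ)) ∨
  (Odd k ∧
    max (((n : ℝ) + 1) / 2) (((n : ℝ) - 1) * r / ((n : ℝ) - 1 - r))
        + Real.sqrt (((n : ℝ) + 1) * r / (2 * ((n : ℝ) - 1 - r))) ≤ (k : ℝ))

/-- The quantity `ψ_n(α, r)`, defined by four cases. -/
def psi (n r : ℕ) (α : ℝ) : ℝ :=
  if Even r ∧ (r : ℝ) ≤ (n : ℝ) / 2 - 1 then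
    sSup {y | ∃ k : ℕ, Odd k ∧ (n : ℝ) - tau n ≤ (k : ℝ) ∧ k ≤ n ∧
      y = (n : ℝ) * rchoose ((n : ℝ) - 2) (r - 1) / (2 * (k : ℝ) - n)
            * (2 * (1 / α - 1) - (1 / α) * ((n : ℝ) + 1) / ((k : ℝ) + 1))}
  else if Odd r ∧ (r : ℝ) ≤ (n : ℝ) / 2 - 1 then
    sSup {y | ∃ k : ℕ, ((n : ℝ) - tau n ≤ (k : ℝ) ∧ k ≤ n) ∧ inF n r k ∧
      y = ((n : ℝ) - 1) * rchoose ((n : ℝ) - 2) (r - 1) / (2 * (k : ℝ) - (n : ℝ) - 1)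
            * (2 * (1 / α - 1) - (1 / α) * (n : ℝ) / (k : ℝ))}
  else if Even r then
    sSup {y | ∃ k : ℕ, Odd k ∧ (n : ℝ) / 2 + 1 ≤ (k : ℝ) ∧ k ≤ n ∧
      y = (k : ℝ) * rchoose ((n : ℝ) - 2) (r + 1) / (2 * (k : ℝ) - n)
            * (2 * (1 / α - 1) - (1 / α) * (n : ℝ) / (k : ℝ))}
  else
    sSup {y | ∃ k : ℕ, Odd k ∧ (n : ℝ) / 2 + 1 ≤ (k : ℝ) ∧ k ≤ n ∧
      y = (k : ℝ) * rchoose ((n : ℝ) - 2) r / (2 * (k : ℝ) - n)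
            * (2 * (1 / α - 1) - (1 / α) * (n : ℝ) / (k : ℝ))}

/-- `ψ_n^+(α,r) := max(ψ_n(α,r), 0)`. -/
def psiPlus (n r : ℕ) (α : ℝ) : ℝ := max (psi n r α) 0

open Polynomial in
/-- The Krawtchouk number `K_k^(a+b)(a)`: the coefficient of `X^k` in `(1 - X)^a (1 + X)^b`. -/
def krawCoeff (a b k : ℕ) : ℤ := ((1 - X) ^ a * (1 + X) ^ b : ℤ[X]).coeff k

lemma krawCoeff_zero_left (b k : ℕ) : krawCoeff 0 b k = b.choose k := by
  simp [krawCoeff, Polynomial.coeff_one_add_X_pow]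

lemma krawCoeff_zero (a b : ℕ) : krawCoeff a b 0 = 1 := by
  simp [krawCoeff, Polynomial.coeff_zero_eq_eval_zero]

lemma krawCoeff_succ_left (a b k : ℕ) :
    krawCoeff (a + 1) b (k + 1) = krawCoeff a b (k + 1) - krawCoeff a b k := by
  unfold krawCoeff
  rw [pow_succ, show ((1 - Polynomial.X) ^ a * (1 - Polynomial.X) * (1 + Polynomial.X) ^ b :
    Polynomial ℤ) = (1 - Polynomial.X) ^ a * (1 + Polynomial.X) ^ b
      - (1 - Polynomial.X) ^ a * (1 + Polynomial.X) ^ b * Polynomial.X by ring,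
    Polynomial.coeff_sub, Polynomial.coeff_mul_X]

lemma krawCoeff_succ_right (a b k : ℕ) :
    krawCoeff a (b + 1) (k + 1) = krawCoeff a b (k + 1) + krawCoeff a b k := by
  unfold krawCoeff
  rw [pow_succ, show ((1 - Polynomial.X) ^ a * ((1 + Polynomial.X) ^ b * (1 + Polynomial.X)) :
    Polynomial ℤ) = (1 - Polynomial.X) ^ a * (1 + Polynomial.X) ^ b
      + (1 - Polynomial.X) ^ a * (1 + Polynomial.X) ^ b * Polynomial.X by ring,
    Polynomial.coeff_add, Polynomial.coeff_mul_X]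

lemma krawCoeff_succ_succ (a b k : ℕ) :
    krawCoeff (a + 1) (b + 1) (k + 2) = krawCoeff a b (k + 2) - krawCoeff a b k := by
  rw [krawCoeff_succ_left, krawCoeff_succ_right, krawCoeff_succ_right]; ring

lemma krawCoeff_succ_succ_one (a b : ℕ) :
    krawCoeff (a + 1) (b + 1) 1 = krawCoeff a b 1 := by
  rw [krawCoeff_succ_left, krawCoeff_succ_right, krawCoeff_zero, krawCoeff_zero]; ring

/-- Symmetry under complementing the argument. -/
lemma krawCoeff_comm (a b k : ℕ) : krawCoeff b a k = (-1) ^ k * krawCoeff a b k := by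
  induction a generalizing b k with
  | zero =>
    induction b generalizing k with
    | zero => cases k <;> simp [krawCoeff_zero_left]
    | succ b ih =>
      cases k with
      | zero => simp [krawCoeff_zero]
      | succ k => rw [krawCoeff_succ_left, krawCoeff_succ_right, ih, ih]; ring
  | succ a ih =>
    cases k with
    | zero => simp [krawCoeff_zero]
    | succ k => rw [krawCoeff_succ_left, krawCoeff_succ_right, ih, ih]; ring

lemma krawCoeff_eq_zero {a b k : ℕ} (h : a + b < k) : krawCoeff a b k = 0 := by
  induction a generalizing k with
  | zero => rw [krawCoeff_zero_left, Nat.choose_eq_zero_of_lt (by omega)]; rfl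
  | succ a ih =>
    cases k with
    | zero => omega
    | succ k => rw [krawCoeff_succ_left, ih (by omega), ih (by omega)]; rfl

/-- Symmetry under complementing the degree. -/
lemma krawCoeff_symm {a b j k : ℕ} (h : j + k = a + b) :
    krawCoeff a b j = (-1) ^ a * krawCoeff a b k := by
  induction a generalizing j k with
  | zero =>
    rw [krawCoeff_zero_left, krawCoeff_zero_left, Nat.choose_symm_of_eq_add (by omega : b = j + k)]
    simp
  | succ a ih =>
    cases j with
    | zero =>
      obtain rfl : k = a + b + 1 := by omega
      rw [krawCoeff_zero, krawCoeff_succ_left, krawCoeff_eq_zero (by omega : a + b < a + b + 1)]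
      have := ih (j := 0) (k := a + b) (by omega)
      rw [krawCoeff_zero] at this
      rw [pow_succ]; linarith
    | succ j =>
      cases k with
      | zero =>
        obtain rfl : j = a + b := by omega
        rw [krawCoeff_zero, krawCoeff_succ_left, krawCoeff_eq_zero (by omega : a + b < a + b + 1)]
        have := ih (j := a + b) (k := 0) (by omega)
        rw [krawCoeff_zero] at this
        rw [pow_succ]; linarith
      | succ k =>
        rw [krawCoeff_succ_left, krawCoeff_succ_left, ih (j := j + 1) (k := k) (by omega),
          ih (j := j) (k := k + 1) (by omega)]
        ring

/-- Summing over a ball lowers dimension and argument by one. -/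
lemma sum_krawCoeff_succ_left (a b r : ℕ) :
    ∑ i ∈ range (r + 1), krawCoeff (a + 1) b i = krawCoeff a b r := by
  induction r with
  | zero => simp [krawCoeff_zero]
  | succ r ih => rw [sum_range_succ, ih, krawCoeff_succ_left]; ring

lemma abs_krawCoeff_comm (a b k : ℕ) : |krawCoeff b a k| = |krawCoeff a b k| := by
  rw [krawCoeff_comm a b k, abs_mul, abs_pow]; simp

lemma abs_krawCoeff_symm {a b j k : ℕ} (h : j + k = a + b) :
    |krawCoeff a b j| = |krawCoeff a b k| := by
  rw [krawCoeff_symm h, abs_mul, abs_pow]; simp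

lemma abs_krawCoeff_le_choose (a b k : ℕ) : |krawCoeff a b k| ≤ (a + b).choose k := by
  induction a generalizing k with
  | zero => simp [krawCoeff_zero_left]
  | succ a ih =>
    cases k with
    | zero => simp [krawCoeff_zero]
    | succ k =>
      rw [krawCoeff_succ_left, show a + 1 + b = a + b + 1 by ring, Nat.choose_succ_succ]
      push_cast
      have := abs_sub (krawCoeff a b (k + 1)) (krawCoeff a b k)
      linarith [ih k, ih (k + 1)]

lemma succ_mul_krawCoeff_one (m k : ℕ) :
    ((m : ℤ) + 1) * krawCoeff 1 m k = (m + 1 - 2 * k) * (m + 1).choose k := by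
  cases k with
  | zero => simp [krawCoeff_zero]
  | succ k =>
    rw [krawCoeff_succ_left, krawCoeff_zero_left, krawCoeff_zero_left]
    have h1 : ((m : ℤ) + 1) * m.choose k = (m + 1).choose (k + 1) * (k + 1) := by
      exact_mod_cast Nat.add_one_mul_choose_eq m k
    have h2 : ((m + 1).choose (k + 1) : ℤ) = m.choose k + m.choose (k + 1) := by
      exact_mod_cast Nat.choose_succ_succ m k
    push_cast
    linear_combination (-(m : ℤ) - 1) * h2 - 2 * h1

lemma krawCoeff_one_nonneg {m k : ℕ} (h : 2 * k ≤ m + 1) : 0 ≤ krawCoeff 1 m k := by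
  have h1 := succ_mul_krawCoeff_one m k
  have h2 : (0 : ℤ) ≤ (m + 1 - 2 * k) * (m + 1).choose k :=
    mul_nonneg (by zify at h; linarith) (by positivity)
  rw [← h1] at h2
  exact nonneg_of_mul_nonneg_right h2 (by positivity)

/-- Away from the two ends of the cube, a Krawtchouk polynomial of degree below `n / 2` is
dominated by its value at `1`. -/
lemma abs_krawCoeff_le_krawCoeff_one {a b k m : ℕ} (ha : 1 ≤ a) (hb : 1 ≤ b)
    (hm : a + b = m + 1) (hk : 2 * k ≤ m) : |krawCoeff a b k| ≤ krawCoeff 1 m k := by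
  induction m using Nat.strong_induction_on generalizing a b k with
  | _ m ih =>
  rcases Nat.eq_zero_or_pos k with rfl | hk0
  · simp [krawCoeff_zero]
  by_cases ha1 : a = 1
  · subst ha1
    obtain rfl : b = m := by omega
    rw [abs_of_nonneg (krawCoeff_one_nonneg (by omega))]
  by_cases hb1 : b = 1
  · subst hb1
    obtain rfl : a = m := by omega
    rw [abs_krawCoeff_comm, abs_of_nonneg (krawCoeff_one_nonneg (by omega))]
  rcases Nat.lt_or_ge (2 * k) m with hlt | hge
  · obtain ⟨b, rfl⟩ : ∃ b', b = b' + 1 := ⟨b - 1, by omega⟩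
    obtain ⟨k, rfl⟩ : ∃ k', k = k' + 1 := ⟨k - 1, by omega⟩
    obtain ⟨m, rfl⟩ : ∃ m', m = m' + 1 := ⟨m - 1, by omega⟩
    rw [krawCoeff_succ_right, krawCoeff_succ_right]
    have h1 := ih m (by omega) (a := a) (b := b) (k := k + 1) ha (by omega) (by omega) (by omega)
    have h2 := ih m (by omega) (a := a) (b := b) (k := k) ha (by omega) (by omega) (by omega)
    exact (abs_add_le _ _).trans (add_le_add h1 h2)
  · obtain ⟨j, rfl⟩ : ∃ j, k = j + 2 := ⟨k - 2, by omega⟩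
    obtain ⟨a, rfl⟩ : ∃ a', a = a' + 1 := ⟨a - 1, by omega⟩
    obtain ⟨b, rfl⟩ : ∃ b', b = b' + 1 := ⟨b - 1, by omega⟩
    obtain rfl : m = 2 * j + 2 + 1 + 1 := by omega
    have h1 := ih (2 * j + 2) (by omega) (a := a) (b := b) (k := j + 1)
      (by omega) (by omega) (by omega) (by omega)
    have h2 := ih (2 * j + 2) (by omega) (a := a) (b := b) (k := j)
      (by omega) (by omega) (by omega) (by omega)
    have h3 : krawCoeff 1 (2 * j + 2) (j + 2) = -krawCoeff 1 (2 * j + 2) (j + 1) := by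
      rw [krawCoeff_symm (by omega : j + 2 + (j + 1) = 1 + (2 * j + 2))]; ring
    rw [abs_krawCoeff_symm (by omega : j + 1 + (j + 2) = a + b)] at h1
    rw [krawCoeff_succ_succ, krawCoeff_succ_right 1 (2 * j + 2 + 1),
      krawCoeff_succ_right 1 (2 * j + 2), krawCoeff_succ_right 1 (2 * j + 2) j, h3]
    have := abs_sub (krawCoeff a b (j + 2)) (krawCoeff a b j)
    linarith

/-- The bound `|K_k(a)| ≤ |1 - 2k/n| C(n,k)` for `1 ≤ a ≤ n - 1`, valid off the middle degree. -/
lemma abs_krawCoeff_mul_le {a b k : ℕ} (ha : 1 ≤ a) (hb : 1 ≤ b) (hk : a + b ≠ 2 * k) :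
    |krawCoeff a b k| * (a + b) ≤ |(a : ℤ) + b - 2 * k| * (a + b).choose k := by
  obtain ⟨m, hm⟩ : ∃ m, a + b = m + 1 := ⟨a + b - 1, by omega⟩
  have hmz : (a : ℤ) + b = m + 1 := by exact_mod_cast hm
  rcases Nat.lt_or_ge (a + b) k with hlt | hge
  · rw [krawCoeff_eq_zero hlt, Nat.choose_eq_zero_of_lt hlt]; simp
  rcases Nat.lt_or_ge m (2 * k) with h | h
  · obtain ⟨j, hj⟩ : ∃ j, j + k = a + b := ⟨a + b - k, by omega⟩
    have h1 := abs_krawCoeff_le_krawCoeff_one ha hb hm (k := j) (by omega)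
    have h2 := succ_mul_krawCoeff_one m j
    have hjz : (j : ℤ) + k = m + 1 := by rw [← hmz]; exact_mod_cast hj
    rw [abs_krawCoeff_symm hj] at h1
    rw [hm, hmz, ← Nat.choose_symm_of_eq_add (by omega : m + 1 = j + k),
      show (m : ℤ) + 1 - 2 * k = -(m + 1 - 2 * j) by linarith, abs_neg,
      abs_of_nonneg (by omega : (0 : ℤ) ≤ m + 1 - 2 * j), ← h2, mul_comm]
    exact mul_le_mul_of_nonneg_left h1 (by positivity)
  · have h1 := abs_krawCoeff_le_krawCoeff_one ha hb hm h
    have h2 := succ_mul_krawCoeff_one m k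
    rw [hm, hmz, abs_of_nonneg (by zify at h; linarith : (0 : ℤ) ≤ m + 1 - 2 * k), ← h2, mul_comm]
    exact mul_le_mul_of_nonneg_left h1 (by positivity)

/-- The middle-degree analogue of `abs_krawCoeff_mul_le`. -/
lemma abs_krawCoeff_middle {a b r : ℕ} (ha : 1 ≤ a) (hb : 1 ≤ b) (hr : a + b = 2 * r) :
    |krawCoeff a b r| * (2 * r - 1) ≤ (2 * r).choose r := by
  have hs := krawCoeff_symm (by omega : r + r = a + b)
  rcases Nat.even_or_odd a with hae | hao
  · obtain ⟨b, rfl⟩ : ∃ b', b = b' + 1 := ⟨b - 1, by omega⟩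
    obtain ⟨r, rfl⟩ : ∃ r', r = r' + 1 := ⟨r - 1, by omega⟩
    have hb1 : 1 ≤ b := by obtain ⟨c, rfl⟩ := hae; omega
    have h1 := krawCoeff_symm (by omega : (r + 1) + r = a + b)
    rw [hae.neg_one_pow, one_mul] at h1
    rw [krawCoeff_succ_right, h1]
    have h2 := abs_krawCoeff_le_krawCoeff_one ha hb1 (m := 2 * r) (k := r) (by omega) le_rfl
    have h3 := succ_mul_krawCoeff_one (2 * r) r
    have h4 : ((2 * (r + 1)).choose (r + 1) : ℤ) = 2 * (2 * r + 1).choose r := by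
      rw [show 2 * (r + 1) = 2 * r + 1 + 1 by ring, Nat.choose_succ_succ,
        Nat.choose_symm_of_eq_add (by omega : 2 * r + 1 = (r + 1) + r)]
      push_cast; ring
    rw [h4, ← two_mul, abs_mul, abs_two]
    push_cast at h3 ⊢
    nlinarith
  · rw [hao.neg_one_pow] at hs
    rw [show krawCoeff a b r = 0 by linarith]
    simp

lemma krawCoeff_middle_of_odd {a b r : ℕ} (ha : Odd a) (hr : a + b = 2 * r) :
    krawCoeff a b r = 0 := by
  have hs := krawCoeff_symm (by omega : r + r = a + b)
  rw [ha.neg_one_pow] at hs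
  linarith

lemma mul_krawCoeff_two (m k : ℕ) :
    ((m : ℤ) + 2) * (m + 1) * krawCoeff 2 m k =
      ((m + 2 - 2 * k) ^ 2 - (m + 2)) * (m + 2).choose k := by
  rcases k with _ | _ | k
  · simp [krawCoeff_zero]; ring
  · rw [krawCoeff_succ_left, krawCoeff_succ_left, krawCoeff_zero, krawCoeff_zero,
      krawCoeff_zero_left]
    simp; ring
  · rw [krawCoeff_succ_left, krawCoeff_succ_left, krawCoeff_succ_left, krawCoeff_zero_left,
      krawCoeff_zero_left, krawCoeff_zero_left]
    have h1 : ((m : ℤ) + 1) * m.choose k = (m + 1).choose (k + 1) * (k + 1) := by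
      exact_mod_cast Nat.add_one_mul_choose_eq m k
    have h2 : ((m : ℤ) + 1 + 1) * (m + 1).choose (k + 1) = (m + 2).choose (k + 2) * (k + 1 + 1) := by
      exact_mod_cast Nat.add_one_mul_choose_eq (m + 1) (k + 1)
    have h3 : ((m + 1).choose (k + 1) : ℤ) = m.choose k + m.choose (k + 1) := by
      exact_mod_cast Nat.choose_succ_succ m k
    have h4 : ((m + 1).choose (k + 2) : ℤ) = m.choose (k + 1) + m.choose (k + 2) := by
      exact_mod_cast Nat.choose_succ_succ m (k + 1)
    have h5 : ((m + 2).choose (k + 2) : ℤ) = (m + 1).choose (k + 1) + (m + 1).choose (k + 2) := by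
      exact_mod_cast Nat.choose_succ_succ (m + 1) (k + 1)
    push_cast
    have e : (m.choose (k + 1 + 1) : ℤ) - m.choose (k + 1) - (m.choose (k + 1) - m.choose k)
        = (m + 2).choose (k + 2) - 4 * (m + 1).choose (k + 1) + 4 * m.choose k := by
      linear_combination -h5 + 3 * h3 - h4
    rw [e]
    linear_combination (-4 * ((m : ℤ) + 1) + 4 * (k + 1)) * h2 + 4 * ((m : ℤ) + 2) * h1

lemma choose_sub_two_mul (m k : ℕ) :
    ((m : ℤ) + 2) * (m + 1) * m.choose k = (m + 2 - k) * (m + 1 - k) * (m + 2).choose k := by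
  rcases Nat.lt_or_ge m k with h | h
  · rw [Nat.choose_eq_zero_of_lt h]
    rcases Nat.lt_or_ge (m + 2) k with h' | h'
    · rw [Nat.choose_eq_zero_of_lt h']; simp
    · rcases (by omega : k = m + 1 ∨ k = m + 2) with rfl | rfl <;> simp
  · have h1 : ((m : ℤ) + 1) * m.choose k = (m + 1).choose k * (m + 1 - k) := by
      have := Nat.choose_mul_succ_eq m k
      rw [mul_comm]; zify [(by omega : k ≤ m + 1)] at this; exact this
    have h2 : ((m : ℤ) + 2) * (m + 1).choose k = (m + 2).choose k * (m + 2 - k) := by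
      have := Nat.choose_mul_succ_eq (m + 1) k
      rw [mul_comm]; zify [(by omega : k ≤ m + 1 + 1)] at this
      convert this using 2 <;> ring
    linear_combination (m + 2 : ℤ) * h1 + (m + 1 - k : ℤ) * h2

lemma choose_sub_two_mul' (m k : ℕ) :
    ((m : ℤ) + 2) * (m + 1) * m.choose k = (k + 2) * (k + 1) * (m + 2).choose (k + 2) := by
  have h1 : ((m : ℤ) + 1) * m.choose k = (m + 1).choose (k + 1) * (k + 1) := by
    exact_mod_cast Nat.add_one_mul_choose_eq m k
  have h2 : ((m : ℤ) + 1 + 1) * (m + 1).choose (k + 1) = (m + 2).choose (k + 2) * (k + 1 + 1) := by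
    exact_mod_cast Nat.add_one_mul_choose_eq (m + 1) (k + 1)
  linear_combination (m + 2 : ℤ) * h1 + (k + 1 : ℤ) * h2

/-- Numerator of the bound in `abs_krawCoeff_quad`. -/
def quadMax (N s : ℤ) : ℤ := max (s ^ 2 - N) N

lemma amgm_cubic {A B : ℤ} (hA : 0 ≤ A) (hB : 0 ≤ B) : 27 * (A ^ 2 * B) ≤ 4 * (A + B) ^ 3 := by
  nlinarith [mul_nonneg (sq_nonneg (A - 2 * B)) (by linarith : 0 ≤ 4 * A + B)]

lemma quad_step_mixed {N k : ℤ} (hN : 14 ≤ N) (hk : 0 ≤ k) (hkN : k ≤ N)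
    (h1 : (N - 2 - 2 * k) ^ 2 - (N - 2) ≤ N - 2)
    (h2 : N - 2 ≤ (N - 2 * k + 2) ^ 2 - (N - 2)) :
    (N - k) * (N - k - 1) * (N - 2) + k * (k - 1) * ((N - 2 * k + 2) ^ 2 - (N - 2)) ≤
      (N - 2) * (N - 3) * max ((N - 2 * k) ^ 2 - N) N := by
  have hN4 : 0 ≤ 4 * (N - 2) * (N - 3) - 2 * (N - 2) - N ^ 2 := by nlinarith
  obtain ⟨s, hs⟩ : ∃ s, s = N - 2 * k := ⟨_, rfl⟩
  have hs0 : 0 ≤ s := by nlinarith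
  have hsN : s ≤ N := by linarith
  have hq : 4 * (k * (k - 1)) ≤ (N - s) ^ 2 := by nlinarith
  have hv : 0 ≤ (s + 2) ^ 2 - 2 * N + 4 := by subst hs; linarith
  have hcub := amgm_cubic (by linarith : 0 ≤ N - s) (by linarith : 0 ≤ s + 2)
  have hN3 : 4 * (4 * (N + 2) ^ 3) ≤ 27 * (2 * ((N - 2) * (N ^ 2 - 6 * N))) := by
    obtain ⟨t, rfl⟩ : ∃ t, N = 14 + t := ⟨N - 14, by ring⟩
    have : 0 ≤ t := by linarith
    have := mul_nonneg this this
    have := mul_nonneg this ‹0 ≤ t›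
    nlinarith
  have hcub' : 4 * ((N - s) ^ 2 * (s + 2)) ≤ 2 * ((N - 2) * (N ^ 2 - 6 * N)) := by
    have : N - s + (s + 2) = N + 2 := by ring
    rw [this] at hcub
    linarith
  have hqv := mul_le_mul_of_nonneg_right hq hv
  have key : 4 * ((N - k) * (N - k - 1) * (N - 2)
      + k * (k - 1) * ((N - 2 * k + 2) ^ 2 - (N - 2))) ≤
      2 * (N - 2) * (N ^ 2 + s ^ 2 - 2 * N) + (N - s) ^ 2 * ((s + 2) ^ 2 - 2 * N + 4) := by
    have : (N - k) * (N - k - 1) * (N - 2)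
      + k * (k - 1) * ((N - 2 * k + 2) ^ 2 - (N - 2)) =
      (N - 2) * ((N - k) * (N - k - 1) + k * (k - 1)) 
        + k * (k - 1) * ((s + 2) ^ 2 - 2 * N + 4) := by subst hs; ring
    have e : 2 * ((N - k) * (N - k - 1) + k * (k - 1)) = N ^ 2 + s ^ 2 - 2 * N := by subst hs; ring
    rw [this, ← e]
    linarith
  have hN2 : 0 ≤ (N - 2) * (N - 3) := by nlinarith
  rcases le_or_gt (s ^ 2) (2 * N) with hu | hu
  · have hm := mul_le_mul_of_nonneg_left (le_max_right ((N - 2 * k) ^ 2 - N) N) hN2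
    refine le_trans ?_ hm
    have : (N - s) ^ 2 * ((s + 2) ^ 2 - 2 * N + 4) ≤ (N - s) ^ 2 * (4 * (s + 2)) :=
      mul_le_mul_of_nonneg_left (by linarith) (sq_nonneg _)
    have := mul_le_mul_of_nonneg_left hu (by linarith : 0 ≤ 2 * (N - 2))
    linarith
  · have hm := mul_le_mul_of_nonneg_left (le_max_left ((N - 2 * k) ^ 2 - N) N) hN2
    refine le_trans ?_ hm
    rw [← hs] at key ⊢
    have h3 : (N - s) ^ 2 ≤ N ^ 2 := pow_le_pow_left₀ (by linarith) (by linarith) 2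
    have h4 := mul_le_mul_of_nonneg_right h3 (by linarith : 0 ≤ s ^ 2 - 2 * N)
    have h5 : 0 ≤ (4 * (N - 2) * (N - 3) - 2 * (N - 2) - N ^ 2) * (s ^ 2 - 2 * N) :=
      mul_nonneg hN4 (by linarith)
    linarith

/-- The arithmetic behind the induction step of `abs_krawCoeff_quad`. -/
lemma quad_step {N k : ℤ} (hN : 6 ≤ N) (hk : 0 ≤ k) (hkN : k ≤ N) :
    (N - k) * (N - k - 1) * quadMax (N - 2) (N - 2 - 2 * k)
      + k * (k - 1) * quadMax (N - 2) (N - 2 * k + 2) ≤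
      (N - 2) * (N - 3) * quadMax N (N - 2 * k) := by
  unfold quadMax
  rcases lt_or_ge N 14 with hlt | hge
  · have : ∀ N ∈ Icc (6 : ℤ) 13, ∀ k ∈ Icc (0 : ℤ) N,
        (N - k) * (N - k - 1) * max ((N - 2 - 2 * k) ^ 2 - (N - 2)) (N - 2)
          + k * (k - 1) * max ((N - 2 * k + 2) ^ 2 - (N - 2)) (N - 2) ≤
          (N - 2) * (N - 3) * max ((N - 2 * k) ^ 2 - N) N := by decide
    exact this N (by simp; omega) k (by simp; omega)
  have hN2 : 0 ≤ (N - 2) * (N - 3) := by nlinarith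
  have hm1 := mul_le_mul_of_nonneg_left (le_max_left ((N - 2 * k) ^ 2 - N) N) hN2
  have hm2 := mul_le_mul_of_nonneg_left (le_max_right ((N - 2 * k) ^ 2 - N) N) hN2
  rcases le_total ((N - 2 - 2 * k) ^ 2 - (N - 2)) (N - 2) with h1 | h1 <;>
    rcases le_total ((N - 2 * k + 2) ^ 2 - (N - 2)) (N - 2) with h2 | h2
  · rw [max_eq_right h1, max_eq_right h2]
    have hu : (N - 2 * k) ^ 2 ≤ 2 * N - 8 := by nlinarith
    refine le_trans ?_ hm2
    have : 0 ≤ (N - 2) * (2 * N * (N - 3) - (N ^ 2 + (N - 2 * k) ^ 2 - 2 * N)) :=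
      mul_nonneg (by linarith) (by nlinarith)
    linarith
  · rw [max_eq_right h1, max_eq_left h2]
    exact quad_step_mixed hge hk hkN h1 h2
  · rw [max_eq_left h1, max_eq_right h2]
    have := quad_step_mixed (k := N - k) hge (by linarith) (by linarith)
      (by linarith) (by linarith)
    rw [show (N - 2 * (N - k)) ^ 2 = (N - 2 * k) ^ 2 by ring] at this
    linarith
  · rw [max_eq_left h1, max_eq_left h2]
    refine le_trans ?_ hm1
    have hu : 2 * N - 8 ≤ (N - 2 * k) ^ 2 := by nlinarith
    have hu2 : (N - 2 * k) ^ 2 ≤ N ^ 2 := by nlinarith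
    have := mul_nonneg (by linarith : 0 ≤ N ^ 2 - (N - 2 * k) ^ 2)
      (by linarith : 0 ≤ (N - 2 * k) ^ 2 - N + 2)
    linarith

lemma mul_abs_krawCoeff_two_le (k m : ℕ) :
    ((m : ℤ) + 2) * (m + 1) * |krawCoeff 2 m k| ≤
      quadMax (m + 2) (m + 2 - 2 * k) * (m + 2).choose k := by
  rw [← abs_of_nonneg (by positivity : (0 : ℤ) ≤ (m + 2) * (m + 1)), ← abs_mul,
    mul_krawCoeff_two, abs_mul, Nat.abs_cast]
  refine mul_le_mul_of_nonneg_right (abs_le'.2 ⟨le_max_left _ _, le_max_of_le_right ?_⟩)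
    (by positivity)
  linarith [sq_nonneg ((m : ℤ) + 2 - 2 * k)]

/-- For `2 ≤ a ≤ n - 2` a Krawtchouk polynomial is dominated by its value at `2`, except for
degrees close to `n / 2`. -/
lemma abs_krawCoeff_quad {a b m : ℕ} (k : ℕ) (ha : 2 ≤ a) (hb : 2 ≤ b) (hm : a + b = m + 2) :
    ((m : ℤ) + 2) * (m + 1) * |krawCoeff a b k| ≤
      quadMax (m + 2) (m + 2 - 2 * k) * (m + 2).choose k := by
  induction m using Nat.strong_induction_on generalizing a b k with
  | _ m ih =>
  by_cases ha2 : a = 2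
  · subst ha2
    obtain rfl : b = m := by omega
    exact mul_abs_krawCoeff_two_le k b
  by_cases hb2 : b = 2
  · subst hb2
    obtain rfl : a = m := by omega
    rw [abs_krawCoeff_comm]
    exact mul_abs_krawCoeff_two_le k a
  rcases Nat.lt_or_ge (a + b) k with hlt | hkn
  · rw [krawCoeff_eq_zero hlt, Nat.choose_eq_zero_of_lt (by omega)]; simp
  obtain ⟨a, rfl⟩ : ∃ a', a = a' + 1 := ⟨a - 1, by omega⟩
  obtain ⟨b, rfl⟩ : ∃ b', b = b' + 1 := ⟨b - 1, by omega⟩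
  have hm4z : (4 : ℤ) ≤ m := by omega
  have hkz : (k : ℤ) ≤ m + 2 := by omega
  have IH : ∀ j : ℕ, (m : ℤ) * (m - 1) * |krawCoeff a b j| ≤
      quadMax m (m - 2 * j) * m.choose j := by
    intro j
    have := ih (m - 2) (by omega) j (a := a) (b := b) (by omega) (by omega) (by omega)
    rw [show m - 2 + 2 = m by omega, Nat.cast_sub (by omega)] at this
    convert this using 2 <;> push_cast <;> ring_nf
  have hpos : (0 : ℤ) ≤ (m + 2) * (m + 1) := by positivity
  have hmpos : (0 : ℤ) < m * (m - 1) := by nlinarith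
  have hrec : (m : ℤ) * (m - 1) * ((m + 2) * (m + 1) * |krawCoeff (a + 1) (b + 1) k|) ≤
      (m + 2).choose k * (((m : ℤ) + 2 - k) * (m + 2 - k - 1) * quadMax m (m - 2 * k)
      + k * (k - 1) * quadMax m (m + 2 - 2 * k + 2)) := by
    have hC := choose_sub_two_mul m k
    have hI := mul_le_mul_of_nonneg_left (IH k) hpos
    rcases k with _ | _ | k
    · simp only [krawCoeff_zero] at hI ⊢
      push_cast at hI hC ⊢
      linear_combination hI + quadMax m (m - 0) * hC
    · simp only [zero_add, krawCoeff_succ_succ_one] at hI hC ⊢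
      push_cast at hI hC ⊢
      linear_combination hI + quadMax m (m - 2) * hC
    · have hC' := choose_sub_two_mul' m k
      have hI' := mul_le_mul_of_nonneg_left (IH k) hpos
      rw [krawCoeff_succ_succ]
      have h1 := mul_le_mul_of_nonneg_left (abs_sub (krawCoeff a b (k + 2)) (krawCoeff a b k))
        (mul_nonneg hmpos.le hpos)
      push_cast at hI hC ⊢
      rw [show (m : ℤ) + 2 - 2 * (k + 1 + 1) + 2 = m - 2 * k by ring]
      simp only [add_assoc, Nat.reduceAdd, Int.reduceAdd] at *
      linear_combination hI + hI' + h1 + quadMax m (m - 2 * (k + 2)) * hC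
        + quadMax m (m - 2 * k) * hC'
  have hs := quad_step (N := (m : ℤ) + 2) (k := k) (by linarith) (by positivity) hkz
  rw [add_sub_cancel_right] at hs
  have hs' := mul_le_mul_of_nonneg_left hs (by positivity : (0 : ℤ) ≤ (m + 2).choose k)
  refine le_of_mul_le_mul_left ?_ hmpos
  linear_combination hrec + hs'

/-- The character `x ↦ ∏_{i ∈ S} x_i` of the cube. -/
def cubeChar {n : ℕ} (S : Finset (Fin n)) (x : Fin n → ℤˣ) : ℤ := ∏ i ∈ S, (x i : ℤ)

lemma cubeChar_mul {n : ℕ} (S : Finset (Fin n)) (x y : Fin n → ℤˣ) :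
    cubeChar S (x * y) = cubeChar S x * cubeChar S y := by
  simp [cubeChar, prod_mul_distrib]

lemma sum_cubeChar {n : ℕ} (z : Fin n → ℤˣ) :
    ∑ S : Finset (Fin n), cubeChar S z = if z = 1 then 2 ^ n else 0 := by
  have h : ∑ S : Finset (Fin n), cubeChar S z = ∏ i, (1 + (z i : ℤ)) := by
    rw [prod_one_add, powerset_univ]; rfl
  rw [h]
  split_ifs with hz
  · subst hz; simp
  · obtain ⟨i, hi⟩ : ∃ i, z i ≠ 1 := by
      by_contra! hc
      exact hz (funext hc)
    refine prod_eq_zero (mem_univ i) ?_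
    rw [(Int.units_eq_one_or (z i)).resolve_left hi]; simp

open Polynomial in
lemma sum_cubeChar_mul_X_pow {n : ℕ} (S : Finset (Fin n)) :
    ∑ z : Fin n → ℤˣ, (C (cubeChar S z) * X ^ hammingDist z 1 : ℤ[X]) =
      (1 - X) ^ S.card * (1 + X) ^ (n - S.card) := by
  have h : ∀ z : Fin n → ℤˣ, (C (cubeChar S z) * X ^ hammingDist z 1 : ℤ[X]) =
      ∏ i, ((if i ∈ S then C (z i : ℤ) else 1) * if z i = 1 then 1 else X) := by
    intro z
    rw [prod_mul_distrib, prod_ite_mem, univ_inter, cubeChar, map_prod]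
    congr 1
    rw [prod_ite, prod_const_one, one_mul, prod_const]
    rfl
  simp_rw [h]
  rw [← Fintype.prod_sum (fun i (u : ℤˣ) =>
    ((if i ∈ S then C (u : ℤ) else 1) * if u = 1 then 1 else X : ℤ[X]))]
  have h2 : ∀ i : Fin n, ∑ u : ℤˣ, ((if i ∈ S then C (u : ℤ) else 1) * if u = 1 then 1 else X : ℤ[X])
      = if i ∈ S then 1 - X else 1 + X := by
    intro i
    rw [show (univ : Finset ℤˣ) = {1, -1} from rfl, sum_pair (by decide)]
    split_ifs <;> simp_all [sub_eq_add_neg]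
  simp_rw [h2]
  rw [prod_ite, prod_const, prod_const]
  congr 2
  · simp
  · rw [filter_not, filter_mem_eq_inter, univ_inter, card_sdiff_of_subset (subset_univ S), card_univ,
      Fintype.card_fin]

lemma sum_hSphere_cubeChar {n : ℕ} (S : Finset (Fin n)) (i : ℕ) :
    ∑ z ∈ hSphere n i, cubeChar S z = krawCoeff S.card (n - S.card) i := by
  rw [krawCoeff, ← sum_cubeChar_mul_X_pow, Polynomial.finsetSum_coeff, hSphere, sum_filter]
  refine sum_congr rfl fun z _ => ?_
  rw [Polynomial.coeff_C_mul, Polynomial.coeff_X_pow]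
  simp [eq_comm]

lemma sum_hBall {n : ℕ} {β : Type*} [AddCommMonoid β] (r : ℕ) (g : (Fin n → ℤˣ) → β) :
    ∑ z ∈ hBall n r, g z = ∑ i ∈ range (r + 1), ∑ z ∈ hSphere n i, g z := by
  have h : ∀ i ∈ range (r + 1), hSphere n i = {z ∈ hBall n r | hammingDist z 1 = i} := by
    intro i hi
    ext z
    simp only [hSphere, hBall, mem_filter, mem_univ, true_and, mem_range] at hi ⊢
    omega
  have hmaps : ∀ z ∈ hBall n r, hammingDist z 1 ∈ range (r + 1) := by
    intro z hz
    simp only [hBall, mem_filter, mem_univ, true_and, mem_range] at hz ⊢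
    omega
  rw [← sum_fiberwise_of_maps_to hmaps]
  exact sum_congr rfl fun i hi => by rw [h i hi]

lemma card_hSphere (n i : ℕ) : (hSphere n i).card = n.choose i := by
  have := sum_hSphere_cubeChar (∅ : Finset (Fin n)) i
  simp only [cubeChar, prod_empty, sum_const, card_empty, krawCoeff_zero_left] at this
  simpa using this

lemma card_hBall (n r : ℕ) : (hBall n r).card = ballBinom n r := by
  rw [card_eq_sum_ones, sum_hBall]
  simp [card_hSphere, ballBinom]

/-- Unnormalised squared Fourier coefficient. -/
def fourierSq {n : ℕ} (f : (Fin n → ℤˣ) → ℝ) (S : Finset (Fin n)) : ℝ :=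
  (∑ x, f x * cubeChar S x) ^ 2

lemma sum_fourierSq_mul {n : ℕ} (f : (Fin n → ℤˣ) → ℝ) (Z : Finset (Fin n → ℤˣ)) :
    ∑ S, fourierSq f S * (∑ z ∈ Z, cubeChar S z : ℤ) =
      2 ^ n * ∑ x, ∑ z ∈ Z, f x * f (x * z) := by
  have h : ∀ x y z : Fin n → ℤˣ, ∑ S : Finset (Fin n),
      ((cubeChar S x : ℝ) * cubeChar S y * cubeChar S z) = if y = x * z then 2 ^ n else 0 := by
    intro x y z
    have hs := sum_cubeChar (x * y * z)
    have hiff : x * y * z = 1 ↔ y = x * z := by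
      have hx : x * x = 1 := by ext i; simp
      have hz : z * z = 1 := by ext i; simp
      constructor
      · intro h
        calc y = (x * x) * y * (z * z) := by rw [hx, hz]; simp
          _ = x * (x * y * z) * z := by simp only [mul_assoc]
          _ = x * z := by rw [h]; simp
      · rintro rfl
        calc x * (x * z) * z = (x * x) * (z * z) := by simp only [mul_assoc]
          _ = 1 := by rw [hx, hz]; simp
    simp only [hiff, cubeChar_mul] at hs
    exact_mod_cast hs
  calc ∑ S, fourierSq f S * (∑ z ∈ Z, cubeChar S z : ℤ)
      = ∑ S : Finset (Fin n), ∑ x, ∑ z ∈ Z, ∑ y,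
          f x * f y * ((cubeChar S x : ℝ) * cubeChar S y * cubeChar S z) := by
        refine sum_congr rfl fun S _ => ?_
        rw [fourierSq, sq, sum_mul_sum, sum_mul]
        refine sum_congr rfl fun x _ => ?_
        rw [sum_comm, sum_mul]
        refine sum_congr rfl fun y _ => ?_
        push_cast
        rw [mul_sum]
        refine sum_congr rfl fun z _ => ?_
        ring
    _ = ∑ x, ∑ z ∈ Z, ∑ y, f x * f y * (if y = x * z then 2 ^ n else 0) := by
        rw [sum_comm]
        refine sum_congr rfl fun x _ => ?_
        rw [sum_comm]
        refine sum_congr rfl fun z _ => ?_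
        rw [sum_comm]
        refine sum_congr rfl fun y _ => ?_
        rw [← mul_sum, h]
    _ = _ := by
        rw [mul_sum]
        refine sum_congr rfl fun x _ => ?_
        rw [mul_sum]
        refine sum_congr rfl fun z _ => ?_
        simp [mul_comm]

/-- Weak duality for the linear program: a nonnegative combination of sphere autocorrelations,
added to the ball autocorrelation, has all its nontrivial Fourier coefficients bounded by `L`. -/
lemma BStab_mul_le_of_dual {n r : ℕ} (A : Finset (Fin n → ℤˣ)) {α y L : ℝ} (s : Finset ℕ)
    (hα : α = (A.card : ℝ) / 2 ^ n) (hy : 0 ≤ y)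
    (hL : ∀ a b : ℕ, a + 1 + b = n →
      (krawCoeff a b r : ℝ) + y * ∑ i ∈ s, (krawCoeff (a + 1) b i : ℝ) ≤ L) :
    BStab n r (indic n A) * ballBinom n r ≤
      α ^ 2 * (ballBinom n r + y * ∑ i ∈ s, (n.choose i : ℝ)) + α * (1 - α) * L := by
  set f := indic n A with hf
  set G : ℝ := ∑ x, ∑ z ∈ hBall n r, f x * f (x * z) with hG
  have hBpos : (0 : ℝ) < ballBinom n r := by
    have : 0 < ballBinom n r :=
      sum_pos' (fun _ _ => Nat.zero_le _) ⟨0, by simp, by simp⟩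
    exact_mod_cast this
  have hB : BStab n r f * ballBinom n r = G / 2 ^ n := by
    rw [BStab, card_hBall]; field_simp; rfl
  have hf0 : ∀ x, 0 ≤ f x := by intro x; simp only [hf, indic]; split_ifs <;> norm_num
  have hFnn : ∀ S, 0 ≤ fourierSq f S := fun S => sq_nonneg _
  have hFempty : fourierSq f ∅ = (A.card : ℝ) ^ 2 := by
    simp [fourierSq, cubeChar, hf, indic]
  have hFsum : ∑ S, fourierSq f S = 2 ^ n * A.card := by
    have := sum_fourierSq_mul f {1}
    simp only [sum_singleton, mul_one] at this
    rw [show (A.card : ℝ) = ∑ x, f x * f x by simp [hf, indic], ← this]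
    refine sum_congr rfl fun S _ => ?_
    simp [cubeChar]
  have hball : 2 ^ n * G = ∑ S, fourierSq f S *
      ∑ i ∈ range (r + 1), (krawCoeff S.card (n - S.card) i : ℝ) := by
    rw [hG, ← sum_fourierSq_mul f (hBall n r)]
    refine sum_congr rfl fun S _ => ?_
    rw [sum_hBall]
    simp only [sum_hSphere_cubeChar]
    push_cast; rfl
  have hsph : 0 ≤ ∑ S, fourierSq f S * ∑ i ∈ s, (krawCoeff S.card (n - S.card) i : ℝ) := by
    simp only [mul_sum]
    rw [sum_comm]
    refine sum_nonneg fun i _ => ?_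
    have := sum_fourierSq_mul f (hSphere n i)
    simp only [sum_hSphere_cubeChar] at this
    rw [this]
    exact mul_nonneg (by positivity)
      (sum_nonneg fun x _ => sum_nonneg fun z _ => mul_nonneg (hf0 _) (hf0 _))
  have hmain : 2 ^ n * G ≤ (A.card : ℝ) ^ 2 * (ballBinom n r + y * ∑ i ∈ s, (n.choose i : ℝ))
      + (2 ^ n * A.card - (A.card : ℝ) ^ 2) * L := by
    calc 2 ^ n * G ≤ 2 ^ n * G
          + y * ∑ S, fourierSq f S * ∑ i ∈ s, (krawCoeff S.card (n - S.card) i : ℝ) :=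
          le_add_of_nonneg_right (mul_nonneg hy hsph)
      _ = ∑ S, fourierSq f S * (∑ i ∈ range (r + 1), (krawCoeff S.card (n - S.card) i : ℝ)
          + y * ∑ i ∈ s, (krawCoeff S.card (n - S.card) i : ℝ)) := by
          rw [hball, mul_sum, ← sum_add_distrib]
          refine sum_congr rfl fun S _ => ?_
          ring
      _ ≤ ∑ S, (fourierSq f S * L + if S = ∅ then (A.card : ℝ) ^ 2 *
            (ballBinom n r + y * ∑ i ∈ s, (n.choose i : ℝ) - L) else 0) := by
          refine sum_le_sum fun S _ => ?_
          split_ifs with hS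
          · subst hS
            rw [hFempty]
            simp only [card_empty, krawCoeff_zero_left, Nat.sub_zero, ballBinom]
            push_cast
            apply le_of_eq; ring
          · rw [add_zero]
            have hc : 0 < S.card := card_pos.2 (nonempty_iff_ne_empty.2 hS)
            have hc' : S.card ≤ n := by simpa using card_le_univ S
            have := hL (S.card - 1) (n - S.card) (by omega)
            rw [← sum_krawCoeff_succ_left, show S.card - 1 + 1 = S.card by omega] at this
            push_cast at this
            exact mul_le_mul_of_nonneg_left this (hFnn S)
      _ = _ := by
          rw [sum_add_distrib, ← sum_mul, hFsum, sum_ite_eq' univ ∅]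
          simp; ring
  rw [hB, hα]
  have h2 : (0 : ℝ) < 2 ^ n := by positivity
  rw [div_le_iff₀ h2]
  refine le_of_mul_le_mul_left (hmain.trans (le_of_eq ?_)) h2
  field_simp

lemma le_of_dual {n r : ℕ} (A : Finset (Fin n → ℤˣ)) {α y c t : ℝ} (s : Finset ℕ)
    (hα : α = (A.card : ℝ) / 2 ^ n) (hα0 : 0 < α) (hy : 0 ≤ y)
    (hs : y * ∑ i ∈ s, (n.choose i : ℝ) = c * t)
    (hL : ∀ a b : ℕ, a + 1 + b = n →
      (krawCoeff a b r : ℝ) + y * ∑ i ∈ s, (krawCoeff (a + 1) b i : ℝ) ≤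
        (n - 1).choose r - c * (2 - t)) :
    c * (2 * (1 / α - 1) - (1 / α) * t) ≤
      (α ^ 2 * ballBinom n r + α * (1 - α) * (n - 1).choose r
        - BStab n r (indic n A) * ballBinom n r) / α ^ 2 := by
  have h := BStab_mul_le_of_dual A s hα hy hL
  rw [hs] at h
  rw [le_div_iff₀ (by positivity)]
  have e : c * (2 * (1 / α - 1) - (1 / α) * t) * α ^ 2 = c * (2 * (1 - α) * α - α * t) := by
    field_simp
  rw [e]
  linarith

/-- `K_k(1)`, normalised. -/
lemma krawCoeff_one_div {m k : ℕ} (hk : k ≤ m + 1) :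
    (krawCoeff 1 m k : ℝ) / (m + 1).choose k = (m + 1 - 2 * k) / (m + 1) := by
  have hC : (0 : ℝ) < (m + 1).choose k := by exact_mod_cast Nat.choose_pos hk
  have h : ((m : ℝ) + 1) * krawCoeff 1 m k = (m + 1 - 2 * k) * (m + 1).choose k := by
    exact_mod_cast succ_mul_krawCoeff_one m k
  rw [div_eq_div_iff hC.ne' (by positivity)]
  linarith

/-- Normalised Krawtchouk polynomials of degree away from `n / 2` are, for `2 ≤ a ≤ n - 2`, at
most their value at `2`. -/
lemma krawCoeff_div_le_two {a b k n : ℕ} (ha : 2 ≤ a) (hb : 2 ≤ b) (hn : a + b = n) (hk : k ≤ n)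
    (h : (n : ℝ) ≤ (2 * k - n) ^ 2 ∧ n ≤ 5 ∨ (2 * n : ℝ) ≤ (2 * k - n) ^ 2) :
    (krawCoeff a b k : ℝ) / n.choose k ≤ ((2 * k - n) ^ 2 - n) / (n * (n - 1)) := by
  have hC : (0 : ℝ) < n.choose k := by exact_mod_cast Nat.choose_pos hk
  obtain ⟨m, rfl⟩ : ∃ m, n = m + 2 := ⟨n - 2, by omega⟩
  have key : ((m : ℝ) + 2) * (m + 1) * |(krawCoeff a b k : ℝ)| ≤
      ((2 * k - (m + 2)) ^ 2 - (m + 2)) * (m + 2).choose k := by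
    push_cast at h
    rcases h with ⟨h, h5⟩ | h
    · have hab : |krawCoeff a b k| = |krawCoeff 2 m k| := by
        rcases (by omega : a = 2 ∨ b = 2) with rfl | rfl
        · rw [show b = m by omega]
        · rw [abs_krawCoeff_comm, show a = m by omega]
      have h2 : ((m : ℝ) + 2) * (m + 1) * krawCoeff 2 m k =
        ((m + 2 - 2 * k) ^ 2 - (m + 2)) * (m + 2).choose k := by
        exact_mod_cast mul_krawCoeff_two m k
      have hab' : |(krawCoeff a b k : ℝ)| = |(krawCoeff 2 m k : ℝ)| := by exact_mod_cast hab
      rw [hab', ← abs_of_nonneg (by positivity : (0 : ℝ) ≤ (m + 2) * (m + 1)), ← abs_mul, h2,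
        abs_of_nonneg]
      · apply le_of_eq; ring
      · exact mul_nonneg (by linarith) hC.le
    · have h2 := abs_krawCoeff_quad k ha hb hn
      have hz : (2 * (m + 2) : ℤ) ≤ (2 * k - (m + 2)) ^ 2 := by exact_mod_cast h
      rw [quadMax, max_eq_left (by linarith)] at h2
      have h3 : ((m : ℝ) + 2) * (m + 1) * |(krawCoeff a b k : ℝ)| ≤
        ((m + 2 - 2 * k) ^ 2 - (m + 2)) * (m + 2).choose k := by exact_mod_cast h2
      linarith
  push_cast
  rw [div_le_div_iff₀ hC (by nlinarith [(Nat.cast_nonneg m : (0 : ℝ) ≤ m)])]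
  have := le_abs_self (krawCoeff a b k : ℝ)
  have := mul_le_mul_of_nonneg_left this (by positivity : (0 : ℝ) ≤ (m + 2) * (m + 1))
  linarith

/-- The dual constraint is tight at weight `1`. -/
lemma dual_constraint_one {x E D N k q : ℝ} (hD : 0 ≤ D) (hN : 1 < N) (hk : N + 1 < 2 * k)
    (hx : x ≤ E) (hq : q ≤ (N - 2 * k) / N) :
    x + (N - 1) * D / (2 * k - N - 1) * (N / k) * q ≤
      E - (N - 1) * D / (2 * k - N - 1) * (2 - N / k) := by
  have hk0 : 0 < k := by linarith
  have hc : 0 ≤ (N - 1) * D / (2 * k - N - 1) :=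
    div_nonneg (mul_nonneg (by linarith) hD) (by linarith)
  have hct : 0 ≤ (N - 1) * D / (2 * k - N - 1) * (N / k) :=
    mul_nonneg hc (div_nonneg (by linarith) hk0.le)
  have h1 := mul_le_mul_of_nonneg_left hq hct
  have h2 : (N - 1) * D / (2 * k - N - 1) * (N / k) * ((N - 2 * k) / N) =
      -((N - 1) * D / (2 * k - N - 1) * (2 - N / k)) := by
    have : 2 * k - N - 1 ≠ 0 := by linarith
    have : N ≠ 0 := by linarith
    field_simp
    ring
  linarith

/-- The dual constraint is tight at weight `2`. -/
lemma dual_constraint_two {x E D N k q : ℝ} (hD : 0 ≤ D) (hN : 1 < N) (hk : N + 1 < 2 * k)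
    (hx : x ≤ E - 2 * D) (hq : q ≤ ((2 * k - N) ^ 2 - N) / (N * (N - 1))) :
    x + (N - 1) * D / (2 * k - N - 1) * (N / k) * q ≤
      E - (N - 1) * D / (2 * k - N - 1) * (2 - N / k) := by
  have hk0 : 0 < k := by linarith
  have hc : 0 ≤ (N - 1) * D / (2 * k - N - 1) :=
    div_nonneg (mul_nonneg (by linarith) hD) (by linarith)
  have hct : 0 ≤ (N - 1) * D / (2 * k - N - 1) * (N / k) :=
    mul_nonneg hc (div_nonneg (by linarith) hk0.le)
  have h1 := mul_le_mul_of_nonneg_left hq hct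
  have h2 : (N - 1) * D / (2 * k - N - 1) * (N / k) * (((2 * k - N) ^ 2 - N) / (N * (N - 1))) =
      2 * D - ((N - 1) * D / (2 * k - N - 1) * (2 - N / k)) := by
    have : 2 * k - N - 1 ≠ 0 := by linarith
    have : N ≠ 0 := by linarith
    have : N - 1 ≠ 0 := by linarith
    field_simp
    ring
  linarith

lemma rchoose_natCast (m j : ℕ) : rchoose m j = m.choose j := by
  rw [rchoose, Nat.cast_choose_eq_descPochhammer_div, descPochhammer_eval_eq_prod_range]

lemma le_of_sub_tau_le {n k : ℕ} (hn : 4 ≤ n) (h : (n : ℝ) - tau n ≤ k) :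
    (n : ℝ) / 2 ≤ 2 * k - n := by
  have : (2 : ℝ) ≤ Real.sqrt ((n : ℝ) / 2 + 2) := by
    apply Real.le_sqrt_of_sq_le
    have : (4 : ℝ) ≤ n := by exact_mod_cast hn
    linarith
  unfold tau at h
  linarith

lemma le_of_sub_tau_le' {n k : ℕ} (hn : 6 ≤ n) (h : (n : ℝ) - tau n ≤ k) :
    (n : ℝ) / 2 + 1 / 5 ≤ 2 * k - n := by
  have : (11 / 5 : ℝ) ≤ Real.sqrt ((n : ℝ) / 2 + 2) := by
    apply Real.le_sqrt_of_sq_le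
    have : (6 : ℝ) ≤ n := by exact_mod_cast hn
    linarith
  unfold tau at h
  linarith

lemma two_mul_le_sq_of_sub_tau_le {n k : ℕ} (hn : 6 ≤ n) (h : (n : ℝ) - tau n ≤ k) :
    (2 * n : ℝ) ≤ (2 * k - n) ^ 2 := by
  have h1 := le_of_sub_tau_le' hn h
  have hnR : (6 : ℝ) ≤ n := by exact_mod_cast hn
  rcases Nat.lt_or_ge n 8 with h8 | h8
  · have h3 : (3 : ℝ) < 2 * k - n := by linarith
    have h4 : n + 4 ≤ 2 * k := by
      have : ((n + 3 : ℕ) : ℝ) < (2 * k : ℕ) := by push_cast; linarith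
      have : n + 3 < 2 * k := by exact_mod_cast this
      omega
    have h5 : (4 : ℝ) ≤ 2 * k - n := by
      have : ((n + 4 : ℕ) : ℝ) ≤ (2 * k : ℕ) := by exact_mod_cast h4
      push_cast at this; linarith
    have : (n : ℝ) ≤ 7 := by exact_mod_cast (by omega : n ≤ 7)
    nlinarith
  · have : (8 : ℝ) ≤ n := by exact_mod_cast h8
    nlinarith

/-- At interior weights the trivial bound improves by `2 * C(n-2, r-1)` when `r < n / 2`. -/
lemma krawCoeff_le_sub {a b r n : ℕ} (ha : 1 ≤ a) (hb : 1 ≤ b) (hn : a + 1 + b = n)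
    (hr1 : 1 ≤ r) (hr : 2 * r + 2 ≤ n) :
    (|krawCoeff a b r| : ℝ) ≤ (n - 1).choose r - 2 * (n - 2).choose (r - 1) := by
  obtain ⟨m, rfl⟩ : ∃ m, n = m + 2 := ⟨n - 2, by omega⟩
  obtain ⟨r, rfl⟩ : ∃ r', r = r' + 1 := ⟨r - 1, by omega⟩
  have h := abs_krawCoeff_le_krawCoeff_one ha hb (m := m) (k := r + 1) (by omega) (by omega)
  rw [krawCoeff_succ_left, krawCoeff_zero_left, krawCoeff_zero_left] at h
  simp only [Nat.add_sub_cancel, show m + 2 - 1 = m + 1 by omega, Nat.choose_succ_succ m r]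
  have h' : (|krawCoeff a b (r + 1)| : ℝ) ≤ m.choose (r + 1) - m.choose r := by exact_mod_cast h
  push_cast
  linarith

lemma choose_pred_mul {n r : ℕ} (hr1 : 1 ≤ r) (hn : 2 ≤ n) :
    ((n - 1).choose r : ℝ) * r = (n - 1) * (n - 2).choose (r - 1) := by
  obtain ⟨m, rfl⟩ : ∃ m, n = m + 2 := ⟨n - 2, by omega⟩
  obtain ⟨r, rfl⟩ : ∃ r', r = r' + 1 := ⟨r - 1, by omega⟩
  have h := Nat.add_one_mul_choose_eq m r
  have h' : ((m : ℝ) + 1) * m.choose r = (m + 1).choose (r + 1) * (r + 1) := by exact_mod_cast h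
  simp only [Nat.add_sub_cancel, show m + 2 - 1 = m + 1 by omega]
  push_cast
  linarith

lemma krawCoeff_le_choose {a b n r : ℕ} (hn : a + 1 + b = n) :
    (krawCoeff a b r : ℝ) ≤ (n - 1).choose r := by
  have h := (le_abs_self _).trans (abs_krawCoeff_le_choose a b r)
  rw [show a + b = n - 1 by omega] at h
  exact_mod_cast h

/-- The dual certificate supported on two consecutive levels. -/
lemma dual_even_small {n r k a b : ℕ} (hr1 : 1 ≤ r) (hr : 2 * r + 2 ≤ n) (hn6 : 6 ≤ n)
    (hk : Odd k) (hkt : (n : ℝ) - tau n ≤ k) (hkn : k ≤ n) (hab : a + 1 + b = n) :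
    (krawCoeff a b r : ℝ) + (n * (n - 2).choose (r - 1) / (2 * k - n)) * ((n + 1) / (k + 1)) *
      (krawCoeff (a + 1) (b + 1) (k + 1) / (n + 1).choose (k + 1)) ≤
      (n - 1).choose r -
        (n * (n - 2).choose (r - 1) / (2 * k - n)) * (2 - (n + 1) / (k + 1)) := by
  have hnR : (6 : ℝ) ≤ n := by exact_mod_cast hn6
  have h1 := le_of_sub_tau_le' hn6 hkt
  have hD : (0 : ℝ) ≤ (n - 2).choose (r - 1) := Nat.cast_nonneg _
  have hc : (n * (n - 2).choose (r - 1) / (2 * k - n) : ℝ) =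
      ((n + 1 : ℝ) - 1) * (n - 2).choose (r - 1) / (2 * (k + 1) - (n + 1) - 1) := by
    congr 1 <;> ring
  rw [hc]
  have hk1 : (n + 1 : ℝ) + 1 < 2 * (k + 1) := by linarith
  have hone : (krawCoeff 1 n (k + 1) : ℝ) / (n + 1).choose (k + 1) =
      ((n + 1 : ℝ) - 2 * (k + 1)) / (n + 1) := by
    rw [krawCoeff_one_div (by omega)]; push_cast; rfl
  rcases Nat.eq_zero_or_pos a with rfl | ha
  · refine dual_constraint_one hD (by linarith) hk1 (krawCoeff_le_choose hab) ?_
    rw [show b + 1 = n by omega, zero_add, hone]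
  rcases Nat.eq_zero_or_pos b with rfl | hb
  · refine dual_constraint_one hD (by linarith) hk1 (krawCoeff_le_choose hab) ?_
    have : krawCoeff (a + 1) (0 + 1) (k + 1) = krawCoeff 1 n (k + 1) := by
      rw [zero_add, krawCoeff_comm, (hk.add_odd odd_one).neg_one_pow, one_mul,
        show a + 1 = n by omega]
    rw [this, hone]
  · refine dual_constraint_two hD (by linarith) hk1
      ((le_abs_self _).trans (krawCoeff_le_sub ha hb hab hr1 hr)) ?_
    have := krawCoeff_div_le_two (a := a + 1) (b := b + 1) (k := k + 1) (n := n + 1)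
      (by omega) (by omega) (by omega) (by omega) (Or.inr (by push_cast; nlinarith))
    push_cast at this
    exact this

/-- The arithmetic content of `inF` for odd levels. -/
lemma mul_le_mul_of_max_add_sqrt_le {n r k : ℝ} (hn : 4 ≤ n) (hr : 1 ≤ r) (hrn : 2 * r + 2 ≤ n)
    (h : max ((n + 1) / 2) ((n - 1) * r / (n - 1 - r)) + √((n + 1) * r / (2 * (n - 1 - r))) ≤ k) :
    (n - 1) * (2 * k - n) * r ≤ (n - 1 - r) * k * (2 * k - n - 1) := by
  have hp : 0 < n - 1 - r := by linarith
  set σ := √((n + 1) * r / (2 * (n - 1 - r))) with hσ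
  have hσ2 : σ ^ 2 = (n + 1) * r / (2 * (n - 1 - r)) := Real.sq_sqrt (by positivity)
  have hσ0 : 0 ≤ σ := Real.sqrt_nonneg _
  have h1 := le_max_left ((n + 1) / 2) ((n - 1) * r / (n - 1 - r))
  have h2 := le_max_right ((n + 1) / 2) ((n - 1) * r / (n - 1 - r))
  have h3 : σ * σ ≤ (k - (n + 1) / 2) * (k - (n - 1) * r / (n - 1 - r)) :=
    mul_le_mul (by linarith) (by linarith) hσ0 (by linarith)
  have h4 : (n + 1) * r / (2 * (n - 1 - r)) ≤
      (k - (n + 1) / 2) * (k - (n - 1) * r / (n - 1 - r)) := by rw [← hσ2]; linarith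
  rw [div_le_iff₀ (by positivity)] at h4
  have h5 : (k - (n + 1) / 2) * (k - (n - 1) * r / (n - 1 - r)) * (2 * (n - 1 - r)) =
      (2 * k - n - 1) * ((n - 1 - r) * k - (n - 1) * r) := by
    field_simp
    ring
  nlinarith

lemma dual_odd_small {n r k a b : ℕ} (hr1 : 1 ≤ r) (hro : Odd r) (hr : 2 * r + 2 ≤ n)
    (hkt : (n : ℝ) - tau n ≤ k) (hkn : k ≤ n) (hF : inF n r k) (hab : a + 1 + b = n) :
    (krawCoeff a b r : ℝ) + ((n - 1) * (n - 2).choose (r - 1) / (2 * k - n - 1)) * (n / k) *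
      (krawCoeff (a + 1) b k / n.choose k) ≤
      (n - 1).choose r -
        ((n - 1) * (n - 2).choose (r - 1) / (2 * k - n - 1)) * (2 - n / k) := by
  have hn4 : 4 ≤ n := by omega
  have hnR : (4 : ℝ) ≤ n := by exact_mod_cast hn4
  have hr1R : (1 : ℝ) ≤ r := by exact_mod_cast hr1
  have hrR : (2 : ℝ) * r + 2 ≤ n := by exact_mod_cast hr
  have h1 := le_of_sub_tau_le hn4 hkt
  have hD : (0 : ℝ) ≤ (n - 2).choose (r - 1) := Nat.cast_nonneg _
  have hE : (0 : ℝ) ≤ (n - 1).choose r := Nat.cast_nonneg _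
  have hk1 : (n : ℝ) + 1 < 2 * k := by linarith
  have hknR : (k : ℝ) ≤ n := by exact_mod_cast hkn
  have hk0 : (0 : ℝ) < k := by linarith
  have hC : (0 : ℝ) < n.choose k := by exact_mod_cast Nat.choose_pos hkn
  have hED := choose_pred_mul hr1 (show 2 ≤ n by omega)
  have hone : (krawCoeff 1 (n - 1) k : ℝ) / n.choose k = ((n : ℝ) - 2 * k) / n := by
    have := krawCoeff_one_div (m := n - 1) (k := k) (by omega)
    rw [Nat.sub_add_cancel (by omega)] at this
    rw [this]; push_cast [Nat.cast_sub (show 1 ≤ n by omega)]; congr 1 <;> ring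
  have hcn : 0 ≤ ((n : ℝ) - 1) * (n - 2).choose (r - 1) / (2 * k - n - 1) :=
    div_nonneg (mul_nonneg (by linarith) hD) (by linarith)
  rcases Nat.eq_zero_or_pos a with rfl | ha
  · refine dual_constraint_one hD (by linarith) hk1 (krawCoeff_le_choose hab) ?_
    rw [zero_add, show b = n - 1 by omega, hone]
  rcases Nat.eq_zero_or_pos b with rfl | hb
  · have hx : (krawCoeff a 0 r : ℝ) = -(n - 1).choose r := by
      rw [krawCoeff_comm, hro.neg_one_pow, krawCoeff_zero_left, show a = n - 1 by omega]
      push_cast; ring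
    have hq : (krawCoeff (a + 1) 0 k : ℝ) = (-1) ^ k * n.choose k := by
      rw [krawCoeff_comm, krawCoeff_zero_left, show a + 1 = n by omega]
      push_cast; ring
    rw [hx, hq, mul_div_cancel_right₀ _ hC.ne']
    have ht : 1 ≤ (n : ℝ) / k := by rw [le_div_iff₀ hk0]; linarith
    rcases Nat.even_or_odd k with hke | hko
    · rw [hke.neg_one_pow]
      have hkr : (n + r + 1 : ℝ) / 2 ≤ k := by
        rcases hF with ⟨_, h⟩ | ⟨h, _⟩
        · exact h
        · exact absurd h (Nat.not_odd_iff_even.mpr hke)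
      have : ((n : ℝ) - 1) * (n - 2).choose (r - 1) / (2 * k - n - 1) ≤ (n - 1).choose r := by
        rw [div_le_iff₀ (by linarith), ← hED]
        exact mul_le_mul_of_nonneg_left (by linarith) hE
      linarith
    · rw [hko.neg_one_pow]
      nlinarith
  rcases (by omega : b = 1 ∨ 2 ≤ b) with rfl | hb2
  · have hx : (krawCoeff a 1 r : ℝ) = -((n - 1).choose r - 2 * (n - 2).choose (r - 1)) := by
      obtain ⟨m, rfl⟩ : ∃ m, n = m + 2 := ⟨n - 2, by omega⟩
      obtain ⟨r, rfl⟩ : ∃ r', r = r' + 1 := ⟨r - 1, by omega⟩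
      rw [krawCoeff_comm, hro.neg_one_pow, krawCoeff_succ_left, krawCoeff_zero_left,
        krawCoeff_zero_left, show a = m by omega]
      simp only [Nat.add_sub_cancel, show m + 2 - 1 = m + 1 by omega, Nat.choose_succ_succ m r]
      push_cast; ring
    have hq : (krawCoeff (a + 1) 1 k : ℝ) / n.choose k = (-1) ^ k * ((n - 2 * k) / n) := by
      rw [krawCoeff_comm, ← hone, show a + 1 = n - 1 by omega]
      push_cast; ring
    rcases Nat.even_or_odd k with hke | hko
    · refine dual_constraint_two hD (by linarith) hk1
        ((le_abs_self _).trans (krawCoeff_le_sub ha hb hab hr1 hr)) ?_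
      rw [hq, hke.neg_one_pow, one_mul, div_le_div_iff₀ (by linarith) (by nlinarith)]
      nlinarith [mul_nonneg (mul_nonneg (by linarith : (0 : ℝ) ≤ n)
        (by linarith : (0 : ℝ) ≤ 2 * k - n)) (by linarith : (0 : ℝ) ≤ 2 * k - 2)]
    · have hFo : max (((n : ℝ) + 1) / 2) (((n : ℝ) - 1) * r / ((n : ℝ) - 1 - r))
          + √(((n : ℝ) + 1) * r / (2 * ((n : ℝ) - 1 - r))) ≤ k := by
        rcases hF with ⟨h, _⟩ | ⟨_, h⟩
        · exact absurd h (Nat.not_even_iff_odd.mpr hko)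
        · exact h
      have haux := mul_le_mul_of_max_add_sqrt_le hnR hr1R hrR hFo
      rw [hx, hq, hko.neg_one_pow]
      have hden : (0 : ℝ) < 2 * k - n - 1 := by linarith
      have hkey : ((n : ℝ) - 1) * (n - 2).choose (r - 1) / (2 * k - n - 1) * ((2 * k - n) / k) ≤
          (n - 1).choose r - (n - 2).choose (r - 1) := by
        rw [div_mul_div_comm, div_le_iff₀ (by positivity)]
        have hEr : ((n - 1).choose r - (n - 2).choose (r - 1) : ℝ) * r =
            (n - 1 - r) * (n - 2).choose (r - 1) := by linarith
        have := mul_le_mul_of_nonneg_left haux hD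
        refine le_of_mul_le_mul_right (a := (r : ℝ)) ?_ (by linarith)
        calc _ = ((n - 2).choose (r - 1) : ℝ) * (((n : ℝ) - 1) * (2 * k - n) * r) := by ring
          _ ≤ _ := this
          _ = (((n - 1).choose r - (n - 2).choose (r - 1) : ℝ) * r) * ((2 * k - n - 1) * k) := by
            rw [hEr]; ring
          _ = _ := by ring
      have e : ((n : ℝ) - 1) * (n - 2).choose (r - 1) / (2 * k - n - 1) * (n / k) *
            (-1 * ((n - 2 * k) / n)) +
          ((n : ℝ) - 1) * (n - 2).choose (r - 1) / (2 * k - n - 1) * (2 - n / k) =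
          2 * (((n : ℝ) - 1) * (n - 2).choose (r - 1) / (2 * k - n - 1) * ((2 * k - n) / k)) := by
        have : (n : ℝ) ≠ 0 := by linarith
        field_simp
        ring
      linarith
  · refine dual_constraint_two hD (by linarith) hk1
      ((le_abs_self _).trans (krawCoeff_le_sub ha hb hab hr1 hr)) ?_
    refine krawCoeff_div_le_two (by omega) hb2 hab hkn ?_
    rcases Nat.lt_or_ge n 6 with h6 | h6
    · refine Or.inl ⟨?_, by omega⟩
      rcases (by omega : n = 4 ∨ n = 5) with rfl | rfl
      · push_cast at *; nlinarith
      · have : (8 : ℝ) ≤ 2 * k := by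
          have h7 : ((7 : ℕ) : ℝ) < ((2 * k : ℕ) : ℝ) := by push_cast at *; linarith
          have h8 : 7 < 2 * k := by exact_mod_cast h7
          exact_mod_cast (show 8 ≤ 2 * k by omega)
        push_cast at *; nlinarith
    · exact Or.inr (two_mul_le_sq_of_sub_tau_le h6 hkt)

lemma sub_mul_choose {n r : ℕ} (hn : 2 ≤ n) :
    ((n : ℝ) - 1) * (n - 2).choose r = (n - 1 - r) * (n - 1).choose r := by
  obtain ⟨m, rfl⟩ : ∃ m, n = m + 2 := ⟨n - 2, by omega⟩
  simp only [Nat.add_sub_cancel, show m + 2 - 1 = m + 1 by omega]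
  rcases Nat.lt_or_ge (m + 1) r with h | h
  · rw [Nat.choose_eq_zero_of_lt h, Nat.choose_eq_zero_of_lt (by omega)]; simp
  · have := Nat.choose_mul_succ_eq m r
    have h2 : (m.choose r : ℝ) * (m + 1) = (m + 1).choose r * (m + 1 - r) := by
      have h3 : ((m.choose r * (m + 1) : ℕ) : ℝ) = ((m + 1).choose r * (m + 1 - r) : ℕ) := by
        rw [this]
      push_cast [Nat.cast_sub h] at h3
      exact h3
    push_cast
    linarith

lemma choose_succ_le_choose {m r : ℕ} (h : m ≤ 2 * r + 1) : m.choose (r + 1) ≤ m.choose r := by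
  have h1 := Nat.choose_succ_right_eq m r
  have h2 : m.choose r * (m - r) ≤ m.choose r * (r + 1) := Nat.mul_le_mul_left _ (by omega)
  exact Nat.le_of_mul_le_mul_right (h1.trans_le h2) (by omega)

/-- The trivial bound improves by `2 * C(n-2, r)` when `r` exceeds half of `n - 1`. -/
lemma krawCoeff_le_sub_of_large {a b n r : ℕ} (ha : 1 ≤ a) (hb : 1 ≤ b) (hab : a + 1 + b = n)
    (hr : n ≤ 2 * r) :
    (krawCoeff a b r : ℝ) ≤ (n - 1).choose r - 2 * (n - 2).choose r := by
  have h := abs_krawCoeff_mul_le ha hb (k := r) (by omega)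
  rw [show a + b = n - 1 by omega, abs_of_neg (by omega : (a : ℤ) + b - 2 * r < 0)] at h
  have hab' : (a : ℝ) + b = n - 1 := by rw [← hab]; push_cast; ring
  have h' : (|krawCoeff a b r| : ℝ) * (a + b) ≤ -(a + b - 2 * r) * (n - 1).choose r := by
    exact_mod_cast h
  have hs := sub_mul_choose (r := r) (show 2 ≤ n by omega)
  have hn : (0 : ℝ) < n - 1 := by
    have : (3 : ℝ) ≤ n := by exact_mod_cast (show 3 ≤ n by omega)
    linarith
  rw [hab'] at h'
  refine (le_abs_self _).trans (le_of_mul_le_mul_right ?_ hn)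
  linarith

/-- The dual constraint for a single odd level, reduced to the interior weights. -/
lemma dual_large {n r k a b : ℕ} {D : ℝ} (hD : 0 ≤ D) (hk : Odd k) (hnk : n + 2 ≤ 2 * k)
    (hkn : k ≤ n) (hab : a + 1 + b = n)
    (hinterior : 1 ≤ a → 1 ≤ b → (krawCoeff a b r : ℝ) +
      n * D / (2 * k - n) * (krawCoeff (a + 1) b k / n.choose k) ≤ (n - 1).choose r - D) :
    (krawCoeff a b r : ℝ) + (k * D / (2 * k - n)) * (n / k) *
      (krawCoeff (a + 1) b k / n.choose k) ≤
      (n - 1).choose r - (k * D / (2 * k - n)) * (2 - n / k) := by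
  have hnkR : (n : ℝ) + 2 ≤ 2 * k := by exact_mod_cast hnk
  have hknR : (k : ℝ) ≤ n := by exact_mod_cast hkn
  have hS : (0 : ℝ) < 2 * k - n := by linarith
  have hn0 : (0 : ℝ) < n := by linarith
  have hk0 : (0 : ℝ) < k := by linarith
  have hC : (0 : ℝ) < n.choose k := by exact_mod_cast Nat.choose_pos hkn
  have e1 : (k * D / (2 * k - n)) * (n / k) = n * D / (2 * k - n : ℝ) := by field_simp
  have e2 : (k * D / (2 * k - n)) * (2 - n / k : ℝ) = D := by
    have : (k : ℝ) * 2 - n ≠ 0 := by linarith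
    field_simp
  rw [e1, e2]
  rcases Nat.eq_zero_or_pos a with rfl | ha
  · have hone := krawCoeff_one_div (m := n - 1) (k := k) (by omega)
    rw [Nat.sub_add_cancel (by omega), show n - 1 = b by omega] at hone
    have hb : (b : ℝ) + 1 = n := by rw [← hab]; push_cast; ring
    rw [zero_add, hone, hb, krawCoeff_zero_left, show b = n - 1 by omega]
    have : n * D / (2 * k - n) * ((n - 2 * k) / n : ℝ) = -D := by
      field_simp; ring
    rw [this]
    push_cast; linarith
  rcases Nat.eq_zero_or_pos b with rfl | hb
  · have hx := krawCoeff_le_choose (r := r) hab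
    have hq : (krawCoeff (a + 1) 0 k : ℝ) / n.choose k = -1 := by
      rw [krawCoeff_comm, krawCoeff_zero_left, hk.neg_one_pow, show a + 1 = n by omega]
      push_cast; field_simp
    rw [hq]
    have : D ≤ n * D / (2 * k - n) := by
      rw [le_div_iff₀ hS]; nlinarith
    linarith
  · exact hinterior ha hb

/-- A normalised Krawtchouk polynomial is, at interior weights, bounded by its value at `1`. -/
lemma krawCoeff_div_le_one {n k a b : ℕ} (hnk : n + 2 ≤ 2 * k) (hkn : k ≤ n) (hb : 1 ≤ b)
    (hab : a + 1 + b = n) :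
    (krawCoeff (a + 1) b k : ℝ) / n.choose k ≤ (2 * k - n) / n := by
  have hC : (0 : ℝ) < n.choose k := by exact_mod_cast Nat.choose_pos hkn
  have hn0 : (0 : ℝ) < n := by exact_mod_cast (show 0 < n by omega)
  have h := abs_krawCoeff_mul_le (a := a + 1) (b := b) (k := k) (by omega) hb (by omega)
  rw [hab, abs_of_neg (by omega : ((a + 1 : ℕ) : ℤ) + b - 2 * k < 0)] at h
  have hab' : (a : ℝ) + 1 + b = n := by exact_mod_cast hab
  have h' : (|krawCoeff (a + 1) b k| : ℝ) * (a + 1 + b) ≤ -(a + 1 + b - 2 * k) * n.choose k := by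
    exact_mod_cast h
  rw [hab'] at h'
  rw [div_le_div_iff₀ hC hn0]
  have := mul_le_mul_of_nonneg_right (le_abs_self (krawCoeff (a + 1) b k : ℝ)) hn0.le
  linarith

lemma dual_large_interior {n r k a b : ℕ} {D : ℝ} (hD : 0 ≤ D) (hnk : n + 2 ≤ 2 * k)
    (hkn : k ≤ n) (hb : 1 ≤ b) (hab : a + 1 + b = n)
    (hx : (krawCoeff a b r : ℝ) ≤ (n - 1).choose r - 2 * D) :
    (krawCoeff a b r : ℝ) +
      n * D / (2 * k - n) * (krawCoeff (a + 1) b k / n.choose k) ≤ (n - 1).choose r - D := by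
  have hnkR : (n : ℝ) + 2 ≤ 2 * k := by exact_mod_cast hnk
  have hn0 : (0 : ℝ) < n := by exact_mod_cast (show 0 < n by omega)
  have hS : (0 : ℝ) < 2 * k - n := by linarith
  have h := mul_le_mul_of_nonneg_left (krawCoeff_div_le_one hnk hkn hb hab)
    (div_nonneg (mul_nonneg hn0.le hD) hS.le)
  have e : n * D / (2 * k - n) * ((2 * k - n) / n : ℝ) = D := by field_simp
  linarith

lemma dual_even_large {n r k a b : ℕ} (hr1 : 1 ≤ r) (hr : n ≤ 2 * r + 1) (hk : Odd k)
    (hnk : n + 2 ≤ 2 * k) (hkn : k ≤ n) (hab : a + 1 + b = n) :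
    (krawCoeff a b r : ℝ) + (k * (n - 2).choose (r + 1) / (2 * k - n)) * (n / k) *
      (krawCoeff (a + 1) b k / n.choose k) ≤
      (n - 1).choose r - (k * (n - 2).choose (r + 1) / (2 * k - n)) * (2 - n / k) := by
  refine dual_large (Nat.cast_nonneg _) hk hnk hkn hab fun ha hb =>
    dual_large_interior (Nat.cast_nonneg _) hnk hkn hb hab ?_
  rcases (by omega : n ≤ 2 * r ∨ n = 2 * r + 1) with h | rfl
  · have h1 := krawCoeff_le_sub_of_large ha hb hab h
    have h2 : ((n - 2).choose (r + 1) : ℝ) ≤ (n - 2).choose r := by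
      exact_mod_cast choose_succ_le_choose (by omega)
    linarith
  · obtain ⟨p, rfl⟩ : ∃ p, r = p + 1 := ⟨r - 1, by omega⟩
    have hmid := abs_krawCoeff_middle ha hb (show a + b = 2 * (p + 1) by omega)
    have hmid' : (|krawCoeff a b (p + 1)| : ℝ) * (2 * (p + 1) - 1) ≤
        (2 * (p + 1)).choose (p + 1) := by
      exact_mod_cast hmid
    have h1 := sub_mul_choose (n := 2 * (p + 1) + 1) (r := p + 1) (by omega)
    simp only [Nat.add_sub_cancel, show 2 * (p + 1) + 1 - 2 = 2 * p + 1 by omega] at h1 ⊢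
    have h2 := Nat.choose_succ_right_eq (2 * p + 1) (p + 1)
    rw [show 2 * p + 1 - (p + 1) = p by omega] at h2
    have h2' : ((2 * p + 1).choose (p + 1 + 1) : ℝ) * (p + 1 + 1) =
        (2 * p + 1).choose (p + 1) * p := by exact_mod_cast h2
    push_cast at h1
    have hp : (0 : ℝ) ≤ p := Nat.cast_nonneg _
    set E : ℝ := ((2 * (p + 1)).choose (p + 1) : ℝ)
    set D : ℝ := ((2 * p + 1).choose (p + 1 + 1) : ℝ)
    set G : ℝ := ((2 * p + 1).choose (p + 1) : ℝ)
    have hEG : E = 2 * G := by nlinarith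
    have hG : 0 ≤ G := Nat.cast_nonneg _
    have hx := le_abs_self (krawCoeff a b (p + 1) : ℝ)
    have hxE : (|krawCoeff a b (p + 1)| : ℝ) ≤ E / (2 * p + 1) := by
      rw [le_div_iff₀ (by linarith)]; linarith
    have hDG : D = G * p / (p + 2) := by
      rw [eq_div_iff (by linarith)]; linarith
    refine hx.trans (hxE.trans ?_)
    rw [hDG, hEG, div_le_iff₀ (by linarith)]
    have : (2 * G - 2 * (G * p / (p + 2))) * (2 * p + 1) = 2 * G * (2 * (2 * p + 1) / (p + 2)) := by
      field_simp; ring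
    rw [this]
    refine le_mul_of_one_le_right (by linarith) ?_
    rw [le_div_iff₀ (by linarith)]
    linarith

lemma dual_odd_large {n r k a b : ℕ} (hro : Odd r) (hr : n ≤ 2 * r + 1) (hk : Odd k)
    (hnk : n + 2 ≤ 2 * k) (hkn : k ≤ n) (hab : a + 1 + b = n) :
    (krawCoeff a b r : ℝ) + (k * (n - 2).choose r / (2 * k - n)) * (n / k) *
      (krawCoeff (a + 1) b k / n.choose k) ≤
      (n - 1).choose r - (k * (n - 2).choose r / (2 * k - n)) * (2 - n / k) := by
  refine dual_large (Nat.cast_nonneg _) hk hnk hkn hab fun ha hb => ?_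
  rcases (by omega : n ≤ 2 * r ∨ n = 2 * r + 1) with h | h
  · exact dual_large_interior (Nat.cast_nonneg _) hnk hkn hb hab
      (krawCoeff_le_sub_of_large ha hb hab h)
  have hr1 : 1 ≤ r := hro.pos
  have hn0 : (0 : ℝ) < n := by exact_mod_cast (show 0 < n by omega)
  have hD : (0 : ℝ) ≤ (n - 2).choose r := Nat.cast_nonneg _
  have hE : ((n - 1).choose r : ℝ) = 2 * (n - 2).choose r := by
    have h1 := sub_mul_choose (n := n) (r := r) (by omega)
    have hnr : (n : ℝ) = 2 * r + 1 := by exact_mod_cast h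
    have hrR : (1 : ℝ) ≤ r := by exact_mod_cast hr1
    rw [hnr] at h1
    nlinarith
  rcases Nat.even_or_odd a with hae | hao
  · obtain ⟨a', rfl⟩ := hae
    have hb2 : 2 ≤ b := by omega
    have hn7 : 7 ≤ n := by
      obtain ⟨p, rfl⟩ := hro
      omega
    have hn7R : (7 : ℝ) ≤ n := by exact_mod_cast hn7
    rcases hkn.eq_or_lt with rfl | hlt
    · have hq : krawCoeff (a' + a' + 1) b k = -1 := by
        rw [krawCoeff_symm (k := 0) (by omega), krawCoeff_zero, Odd.neg_one_pow ⟨a', by ring⟩,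
          mul_one]
      have hx := krawCoeff_le_choose (r := r) hab
      have e : (k : ℝ) * (k - 2).choose r / (2 * k - k) = (k - 2).choose r := by
        rw [show (2 * k - k : ℝ) = k by ring]; field_simp
      rw [hq, Nat.choose_self, e]
      push_cast
      linarith
    · have hS3 : (3 : ℝ) ≤ 2 * k - n := by
        have : n + 3 ≤ 2 * k := by omega
        have : ((n + 3 : ℕ) : ℝ) ≤ (2 * k : ℕ) := by exact_mod_cast this
        push_cast at this; linarith
      have hSn : (2 * k - n : ℝ) ≤ n - 2 := by
        have : ((k + 1 : ℕ) : ℝ) ≤ n := by exact_mod_cast hlt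
        push_cast at this; linarith
      set S : ℝ := 2 * k - n with hS
      have hC : (0 : ℝ) < n.choose k := by exact_mod_cast Nat.choose_pos hkn
      have hmid := abs_krawCoeff_middle ha hb (show a' + a' + b = 2 * r by omega)
      have hmid' : (|krawCoeff (a' + a') b r| : ℝ) * (2 * r - 1) ≤ (2 * r).choose r := by
        exact_mod_cast hmid
      rw [show 2 * r = n - 1 by omega, hE, show (2 * r - 1 : ℝ) = n - 2 by rw [h]; push_cast; ring]
        at hmid'
      have hx : (krawCoeff (a' + a') b r : ℝ) ≤ 2 * (n - 2).choose r / (n - 2) := by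
        rw [le_div_iff₀ (by linarith)]
        have := mul_le_mul_of_nonneg_right (le_abs_self (krawCoeff (a' + a') b r : ℝ))
          (by linarith : (0 : ℝ) ≤ n - 2)
        linarith
      have hq : (krawCoeff (a' + a' + 1) b k : ℝ) / n.choose k ≤
          (n - 4) / (n - 2) * S / n := by
        have hquad := abs_krawCoeff_quad (a := a' + a' + 1) (b := b) (m := n - 2) k (by omega) hb2
          (by omega)
        rw [Nat.sub_add_cancel (by omega),
          show (((n - 2 : ℕ) : ℤ) + 2) = n by omega, show (((n - 2 : ℕ) : ℤ) + 1) = n - 1 by omega]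
          at hquad
        have hquad' : (n : ℝ) * (n - 1) * |(krawCoeff (a' + a' + 1) b k : ℝ)| ≤
            max (((n : ℝ) - 2 * k) ^ 2 - n) (n : ℝ) * n.choose k := by
          unfold quadMax at hquad
          exact_mod_cast hquad
        have hmax : max (((n : ℝ) - 2 * k) ^ 2 - n) (n : ℝ) ≤ (n - 4) / (n - 2) * S * (n - 1) := by
          rw [show ((n : ℝ) - 2 * k) ^ 2 = S ^ 2 by rw [hS]; ring, div_mul_eq_mul_div,
            div_mul_eq_mul_div, le_div_iff₀ (by linarith)]
          rcases max_cases (S ^ 2 - (n : ℝ)) n with ⟨hm, _⟩ | ⟨hm, _⟩ <;> rw [hm]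
          · nlinarith [mul_nonneg (by linarith : (0 : ℝ) ≤ n - 2 - S)
              (by nlinarith : (0 : ℝ) ≤ (n - 2) * S + n)]
          · nlinarith [mul_nonneg (mul_nonneg (by linarith : (0 : ℝ) ≤ n - 4)
              (by linarith : (0 : ℝ) ≤ n - 1)) (by linarith : (0 : ℝ) ≤ S - 3)]
        rw [div_le_div_iff₀ hC hn0]
        have h1 := mul_le_mul_of_nonneg_right hmax hC.le
        have h2 := mul_le_mul_of_nonneg_left (le_abs_self (krawCoeff (a' + a' + 1) b k : ℝ))
          (by nlinarith : (0 : ℝ) ≤ n * (n - 1))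
        refine le_of_mul_le_mul_right (a := (n : ℝ) - 1) ?_ (by linarith)
        linarith
      have hmul := mul_le_mul_of_nonneg_left hq
        (by positivity : (0 : ℝ) ≤ n * (n - 2).choose r / S)
      have e : n * (n - 2).choose r / S * ((n - 4) / (n - 2) * S / n) + 2 * (n - 2).choose r / (n - 2)
          = ((n - 2).choose r : ℝ) := by
        have : (n : ℝ) - 2 ≠ 0 := by linarith
        field_simp
        ring
      linarith
  · refine dual_large_interior hD hnk hkn hb hab ?_
    rw [krawCoeff_middle_of_odd hao (by omega), hE]
    simp

lemma le_of_dual_single {n r k : ℕ} (A : Finset (Fin n → ℤˣ)) {α c t : ℝ}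
    (hα : α = (A.card : ℝ) / 2 ^ n) (hα0 : 0 < α) (hct : 0 ≤ c * t) (hkn : k ≤ n)
    (hL : ∀ a b : ℕ, a + 1 + b = n →
      (krawCoeff a b r : ℝ) + c * t * (krawCoeff (a + 1) b k / n.choose k) ≤
        (n - 1).choose r - c * (2 - t)) :
    c * (2 * (1 / α - 1) - (1 / α) * t) ≤
      (α ^ 2 * ballBinom n r + α * (1 - α) * (n - 1).choose r
        - BStab n r (indic n A) * ballBinom n r) / α ^ 2 := by
  have hC : (0 : ℝ) < n.choose k := by exact_mod_cast Nat.choose_pos hkn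
  refine le_of_dual A {k} (y := c * t / n.choose k) hα hα0 (by positivity) ?_ fun a b hab => ?_
  · rw [sum_singleton]; field_simp
  · rw [sum_singleton, div_mul_eq_mul_div, mul_div_assoc]
    exact hL a b hab

lemma le_of_dual_pair {n r k : ℕ} (A : Finset (Fin n → ℤˣ)) {α c t : ℝ}
    (hα : α = (A.card : ℝ) / 2 ^ n) (hα0 : 0 < α) (hct : 0 ≤ c * t) (hkn : k ≤ n)
    (hL : ∀ a b : ℕ, a + 1 + b = n →
      (krawCoeff a b r : ℝ) +
        c * t * (krawCoeff (a + 1) (b + 1) (k + 1) / (n + 1).choose (k + 1)) ≤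
        (n - 1).choose r - c * (2 - t)) :
    c * (2 * (1 / α - 1) - (1 / α) * t) ≤
      (α ^ 2 * ballBinom n r + α * (1 - α) * (n - 1).choose r
        - BStab n r (indic n A) * ballBinom n r) / α ^ 2 := by
  have hC : (0 : ℝ) < (n + 1).choose (k + 1) := by
    exact_mod_cast Nat.choose_pos (show k + 1 ≤ n + 1 by omega)
  refine le_of_dual A {k, k + 1} (y := c * t / (n + 1).choose (k + 1)) hα hα0 (by positivity) ?_
    fun a b hab => ?_
  · rw [sum_pair (by omega), ← Nat.cast_add, ← Nat.choose_succ_succ]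
    field_simp
  · have e : (krawCoeff (a + 1) b k : ℝ) + krawCoeff (a + 1) b (k + 1) =
        krawCoeff (a + 1) (b + 1) (k + 1) := by
      rw [krawCoeff_succ_right]; push_cast; ring
    rw [sum_pair (by omega), e, div_mul_eq_mul_div, mul_div_assoc]
    exact hL a b hab

lemma deficit_nonneg {n r : ℕ} (A : Finset (Fin n → ℤˣ)) {α : ℝ}
    (hα : α = (A.card : ℝ) / 2 ^ n) (hα0 : 0 < α) :
    0 ≤ (α ^ 2 * ballBinom n r + α * (1 - α) * (n - 1).choose r
        - BStab n r (indic n A) * ballBinom n r) / α ^ 2 := by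
  have := le_of_dual_single (r := r) (c := 0) (t := 0) A hα hα0 (by simp) (Nat.zero_le n)
    fun a b hab => by simpa using krawCoeff_le_choose hab
  simpa using this

lemma rchoose_sub_two {n : ℕ} (hn : 2 ≤ n) (j : ℕ) :
    rchoose ((n : ℝ) - 2) j = (n - 2).choose j := by
  rw [← rchoose_natCast, Nat.cast_sub hn, Nat.cast_ofNat]

lemma two_mul_add_two_le_of_le {n r : ℕ} (h : (r : ℝ) ≤ n / 2 - 1) : 2 * r + 2 ≤ n := by
  have : ((2 * r + 2 : ℕ) : ℝ) ≤ n := by push_cast; linarith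
  exact_mod_cast this

lemma le_two_mul_of_le {n k : ℕ} (h : (n : ℝ) / 2 + 1 ≤ k) : n + 2 ≤ 2 * k := by
  have : ((n + 2 : ℕ) : ℝ) ≤ (2 * k : ℕ) := by push_cast; linarith
  exact_mod_cast this

lemma psi_le_deficit {n r : ℕ} (A : Finset (Fin n → ℤˣ)) {α : ℝ} (hr1 : 1 ≤ r)
    (hα : α = (A.card : ℝ) / 2 ^ n) (hα0 : 0 < α) :
    psi n r α ≤ (α ^ 2 * ballBinom n r + α * (1 - α) * (n - 1).choose r
        - BStab n r (indic n A) * ballBinom n r) / α ^ 2 := by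
  have hβ := deficit_nonneg (r := r) A hα hα0
  unfold psi
  split_ifs with h1 h2 h3
  · obtain ⟨he, hr⟩ := h1
    have hr := two_mul_add_two_le_of_le hr
    have hn6 : 6 ≤ n := by obtain ⟨p, rfl⟩ := he; omega
    refine Real.sSup_le ?_ hβ
    rintro _ ⟨k, hk, hkt, hkn, rfl⟩
    have h := le_of_sub_tau_le' hn6 hkt
    have hnR : (0 : ℝ) ≤ n := Nat.cast_nonneg n
    rw [rchoose_sub_two (by omega), mul_div_assoc (1 / α)]
    refine le_of_dual_pair A hα hα0 ?_ hkn fun a b hab =>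
      dual_even_small hr1 hr hn6 hk hkt hkn hab
    have : (0 : ℝ) < 2 * k - n := by linarith
    positivity
  · obtain ⟨ho, hr⟩ := h2
    have hr := two_mul_add_two_le_of_le hr
    refine Real.sSup_le ?_ hβ
    rintro _ ⟨k, ⟨hkt, hkn⟩, hF, rfl⟩
    have hnR : (4 : ℝ) ≤ n := by exact_mod_cast (show 4 ≤ n by omega)
    have h := le_of_sub_tau_le (by omega) hkt
    rw [rchoose_sub_two (by omega), mul_div_assoc (1 / α)]
    refine le_of_dual_single A hα hα0 ?_ hkn fun a b hab =>
      dual_odd_small hr1 ho hr hkt hkn hF hab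
    have : (0 : ℝ) < 2 * k - n - 1 := by linarith
    have : (0 : ℝ) < n - 1 := by linarith
    positivity
  · have hr : n ≤ 2 * r + 1 := by
      by_contra hlt
      refine h1 ⟨h3, ?_⟩
      have : ((2 * r + 2 : ℕ) : ℝ) ≤ n := by exact_mod_cast (show 2 * r + 2 ≤ n by omega)
      push_cast at this; linarith
    refine Real.sSup_le ?_ hβ
    rintro _ ⟨k, hk, hnk, hkn, rfl⟩
    have : (0 : ℝ) < 2 * k - n := by linarith
    have hnk := le_two_mul_of_le hnk
    rw [rchoose_sub_two (by omega), mul_div_assoc (1 / α)]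
    exact le_of_dual_single A hα hα0 (by positivity) hkn fun a b hab =>
      dual_even_large hr1 hr hk hnk hkn hab
  · have ho : Odd r := Nat.not_even_iff_odd.mp h3
    have hr : n ≤ 2 * r + 1 := by
      by_contra hlt
      refine h2 ⟨ho, ?_⟩
      have : ((2 * r + 2 : ℕ) : ℝ) ≤ n := by exact_mod_cast (show 2 * r + 2 ≤ n by omega)
      push_cast at this; linarith
    refine Real.sSup_le ?_ hβ
    rintro _ ⟨k, hk, hnk, hkn, rfl⟩
    have : (0 : ℝ) < 2 * k - n := by linarith
    have hnk := le_two_mul_of_le hnk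
    rw [rchoose_sub_two (by omega), mul_div_assoc (1 / α)]
    exact le_of_dual_single A hα hα0 (by positivity) hkn fun a b hab =>
      dual_odd_large ho hr hk hnk hkn hab

lemma ballBinom_pos (n r : ℕ) : 0 < ballBinom n r :=
  sum_pos' (fun _ _ => Nat.zero_le _) ⟨0, by simp, by simp⟩

/-- Theorem 2, part 1; the linear programming bound:
for `1 ≤ r ≤ n`, `1 ≤ M ≤ 2^n`, and `α = M/2^n ≤ 1/2`,
`Γ_B^(n)(M,r) ≤ α²·[1 − ψ_n^+(α,r)/C(n,≤r)] + α(1−α)·C(n−1,r)/C(n,≤r)`. -/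
theorem lp_bound (n r M : ℕ) (hn : 1 ≤ n) (hr1 : 1 ≤ r) (hrn : r ≤ n)
    (hM1 : 1 ≤ M) (hM2 : M ≤ 2 ^ n) (α : ℝ) (hα : α = (M : ℝ) / 2 ^ n)
    (hhalf : α ≤ 1 / 2) :
    GammaB n M r ≤
      α ^ 2 * (1 - psiPlus n r α / (ballBinom n r : ℝ))
        + α * (1 - α) * ((n - 1).choose r : ℝ) / (ballBinom n r : ℝ) := by
  have hM0 : (0 : ℝ) < M := by exact_mod_cast hM1
  have hα0 : 0 < α := by rw [hα]; positivity
  have hB : (0 : ℝ) < ballBinom n r := by exact_mod_cast ballBinom_pos n r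
  refine csSup_le ?_ ?_
  · obtain ⟨A, _, hA⟩ := exists_subset_card_eq (s := (univ : Finset (Fin n → ℤˣ))) (n := M)
      (by simpa using hM2)
    exact ⟨_, A, hA, rfl⟩
  · rintro _ ⟨A, rfl, rfl⟩
    have h : psiPlus n r α ≤ _ :=
      max_le (psi_le_deficit A hr1 hα hα0) (deficit_nonneg (r := r) A hα hα0)
    rw [le_div_iff₀ (by positivity)] at h
    rw [← mul_le_mul_iff_left₀ hB]
    have e : (α ^ 2 * (1 - psiPlus n r α / (ballBinom n r : ℝ))
        + α * (1 - α) * ((n - 1).choose r : ℝ) / (ballBinom n r : ℝ)) * ballBinom n r =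
        α ^ 2 * ballBinom n r - psiPlus n r α * α ^ 2 + α * (1 - α) * (n - 1).choose r := by
      field_simp
    rw [e]
    linarith
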